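/- arXiv:1511.09051 — 9 statements merged into one kernel-verified Lean document; each statement's English description precedes it below -/
import Mathlib

section
/- Let ι be a nonempty index type, H a group, (G_i)_{i∈ι} a family of groups, and φ_i : H → G_i injective group homomorphisms; let G = *_H G_i be their amalgamated free product, with canonical injections κ_i : G_i → G. If K is a subgroup of G of bounded length, i.e., there exists N ∈ ℕ such that every element of K can be written as a product of at most N elements each lying in the image of some κ_i, then K is contained in a conjugate of one of the factors: there exist g ∈ G and i ∈ ι with g⁻¹Kg ⊆ κ_i(G_i). -/
namespace Monoid.PushoutI

open Classical in
/-- Twice the Gromov product of two reversed normal words: each common initial letter contributes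
`2`, and `1` is added if the first differing letters lie in the same factor. -/
noncomputable def branching {ι : Type*} {X : ι → Type*} : List (Σ i, X i) → List (Σ i, X i) → ℕ
  | a :: r, b :: s => if a = b then branching r s + 2 else if a.1 = b.1 then 1 else 0
  | _, _ => 0

theorem min_branching_le {ι : Type*} {X : ι → Type*} (r s t : List (Σ i, X i)) :
    min (branching r s) (branching s t) ≤ branching r t := by
  induction r generalizing s t with
  | nil => simp [branching]
  | cons a r ih =>
    rcases s with _ | ⟨b, s⟩
    · simp [branching]
    rcases t with _ | ⟨c, t⟩
    · simp [branching]
    have := ih s t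
    simp only [branching]
    grind

variable {ι : Type*} {H : Type*} [Group H] {G : ι → Type*} [∀ i, Group (G i)]
  {φ : ∀ i, H →* G i}

variable (φ) in
/-- The product in the amalgam of a list of letters taken from the factors. -/
def letterProd (l : List (Σ i, G i)) : PushoutI φ :=
  (l.map fun a => of a.1 a.2).prod

variable (φ) in
/-- A list of letters is reduced if no letter comes from the base group and adjacent letters come
from different factors. -/
def IsReducedList (l : List (Σ i, G i)) : Prop :=
  (∀ a ∈ l, a.2 ∉ (φ a.1).range) ∧ l.IsChain fun a b => a.1 ≠ b.1

/-- The inverse of a letter. -/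
def invLetter (a : Σ i, G i) : Σ i, G i := ⟨a.1, a.2⁻¹⟩

@[simp]
theorem letterProd_nil : letterProd φ [] = 1 := rfl

@[simp]
theorem letterProd_cons (a : Σ i, G i) (l : List (Σ i, G i)) :
    letterProd φ (a :: l) = of a.1 a.2 * letterProd φ l := by
  simp [letterProd]

@[simp]
theorem letterProd_append (l l' : List (Σ i, G i)) :
    letterProd φ (l ++ l') = letterProd φ l * letterProd φ l' := by
  simp [letterProd]

theorem letterProd_map_invLetter (l : List (Σ i, G i)) :
    letterProd φ (l.map invLetter) = (letterProd φ l.reverse)⁻¹ := by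
  induction l with
  | nil => simp
  | cons a l ih => simp [ih, invLetter]

namespace IsReducedList

theorem reverse_append_map_invLetter {r s : List (Σ i, G i)} (hr : IsReducedList φ r)
    (hs : IsReducedList φ s) (hrs : ∀ a ∈ r.head?, ∀ b ∈ s.head?, a.1 ≠ b.1) :
    IsReducedList φ (r.reverse ++ s.map invLetter) := by
  refine ⟨fun a ha => ?_, ?_⟩
  · simp only [List.mem_append, List.mem_reverse, List.mem_map] at ha
    rcases ha with ha | ⟨b, hb, rfl⟩
    · exact hr.1 a ha
    · exact fun h => hs.1 b hb (inv_mem_iff.1 h)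
  · rw [List.isChain_append, List.isChain_reverse, List.isChain_map]
    refine ⟨hr.2.imp fun _ _ h => h.symm, hs.2, fun a ha b hb => ?_⟩
    rw [List.getLast?_reverse] at ha
    rw [List.head?_map, Option.mem_def, Option.map_eq_some_iff] at hb
    obtain ⟨c, hc, rfl⟩ := hb
    exact hrs a ha c hc

theorem of_cons {a : Σ i, G i} {l : List (Σ i, G i)} (h : IsReducedList φ (a :: l)) :
    IsReducedList φ l :=
  ⟨fun b hb => h.1 b (List.mem_cons_of_mem _ hb), h.2.tail⟩

theorem reverse {l : List (Σ i, G i)} (h : IsReducedList φ l) : IsReducedList φ l.reverse := by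
  simpa using h.reverse_append_map_invLetter (s := []) ⟨by simp, by simp⟩ (by simp)

theorem of_append_left {l l' : List (Σ i, G i)} (h : IsReducedList φ (l ++ l')) :
    IsReducedList φ l :=
  ⟨fun a ha => h.1 a (List.mem_append_left _ ha), h.2.left_of_append⟩

theorem of_append_right {l l' : List (Σ i, G i)} (h : IsReducedList φ (l ++ l')) :
    IsReducedList φ l' :=
  ⟨fun a ha => h.1 a (List.mem_append_right _ ha), h.2.right_of_append⟩

theorem head_ne {a b : Σ i, G i} {l : List (Σ i, G i)} (h : IsReducedList φ (a :: l))
    (hb : b ∈ l.head?) : a.1 ≠ b.1 :=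
  (List.isChain_cons.1 h.2).1 b hb

end IsReducedList

namespace NormalWord

variable {d : Transversal φ}

variable (d) in
theorem prod_surjective : Function.Surjective (prod : NormalWord d → PushoutI φ) := by
  classical
  exact equiv.symm.surjective

theorem prod_eq_base_mul_letterProd (w : NormalWord d) :
    w.prod = base φ w.head * letterProd φ w.toList := by
  simp [prod, CoprodI.Word.prod, letterProd, map_list_prod, Function.comp_def]

theorem isReducedList_toList (w : NormalWord d) : IsReducedList φ w.toList := by
  refine ⟨fun a ha hr => w.ne_one a ha ?_, w.chain_ne⟩
  have ht : a.2 ∈ d.set a.1 := w.normalized a.1 a.2 ha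
  replace hr := (Subgroup.IsComplement.coe_equiv_snd_eq_one_iff_mem (d.compl a.1) (d.one_mem _)).2 hr
  rwa [(Subgroup.IsComplement.equiv_snd_eq_self_iff_mem (d.compl a.1) (one_mem _)).2 ht] at hr

theorem Transversal.eq_of_mul_inv_mem {i : ι} {a b : G i} (ha : a ∈ d.set i) (hb : b ∈ d.set i)
    (h : a * b⁻¹ ∈ (φ i).range) : a = b := by
  have := @(d.compl i).1 (⟨_, h⟩, ⟨b, hb⟩) (1, ⟨a, ha⟩) (by simp)
  exact (congrArg (fun p => (p.2 : G i)) this).symm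

end NormalWord

open NormalWord

variable (d : Transversal φ)

/-- The syllable length of an element of the amalgam: the number of letters of its normal form. -/
noncomputable def syllableLength (x : PushoutI φ) : ℕ :=
  (Function.surjInv (prod_surjective d) x).toList.length

theorem syllableLength_prod (w : NormalWord d) : syllableLength d w.prod = w.toList.length := by
  rw [syllableLength, prod_injective (Function.surjInv_eq (prod_surjective d) w.prod)]

theorem syllableLength_base_mul_letterProd (h : H) {l : List (Σ i, G i)}
    (hl : IsReducedList φ l) : syllableLength d (base φ h * letterProd φ l) = l.length := by
  classical
  let w : CoprodI.Word G :=
    ⟨l, fun a ha h1 => hl.1 a ha (h1 ▸ one_mem _), hl.2⟩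
  have hw : Reduced φ w := hl.1
  obtain ⟨w', hw', hmap⟩ := hw.exists_normalWord_prod_eq d
  have hprod : ofCoprodI w.prod = letterProd φ l := by
    simp [w, CoprodI.Word.prod, letterProd, map_list_prod, Function.comp_def]
  rw [← hprod, ← hw', ← prod_base_smul, syllableLength_prod, base_smul_def']
  simpa using congrArg List.length hmap

theorem syllableLength_letterProd {l : List (Σ i, G i)} (hl : IsReducedList φ l) :
    syllableLength d (letterProd φ l) = l.length := by
  simpa using syllableLength_base_mul_letterProd d 1 hl

theorem exists_normalized_list (x : PushoutI φ) :
    ∃ (h : H) (l : List (Σ i, G i)), IsReducedList φ l ∧ (∀ a ∈ l, a.2 ∈ d.set a.1) ∧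
      x = base φ h * letterProd φ l ∧ syllableLength d x = l.length := by
  obtain ⟨w, rfl⟩ := prod_surjective d x
  exact ⟨w.head, w.toList, w.isReducedList_toList, fun a ha => w.normalized a.1 a.2 ha,
    w.prod_eq_base_mul_letterProd, syllableLength_prod d w⟩

theorem syllableLength_base_mul (h : H) (x : PushoutI φ) :
    syllableLength d (base φ h * x) = syllableLength d x := by
  obtain ⟨h', l, hl, -, rfl, hlen⟩ := exists_normalized_list d x
  rw [hlen, ← mul_assoc, ← map_mul, syllableLength_base_mul_letterProd d _ hl]

theorem syllableLength_mul_base (x : PushoutI φ) (h : H) :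
    syllableLength d (x * base φ h) = syllableLength d x := by
  obtain ⟨h', l, hl, -, rfl, hlen⟩ := exists_normalized_list d x
  rw [hlen, mul_assoc, syllableLength_base_mul]
  rcases l.eq_nil_or_concat' with rfl | ⟨l, a, rfl⟩
  · simpa using syllableLength_base_mul_letterProd d h (l := []) ⟨by simp, by simp⟩
  · have hl' : IsReducedList φ (l ++ [⟨a.1, a.2 * φ a.1 h⟩]) := by
      refine ⟨fun b hb => ?_, ?_⟩
      · rcases List.mem_append.1 hb with hb | hb
        · exact hl.1 b (List.mem_append_left _ hb)
        · obtain rfl := List.mem_singleton.1 hb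
          rw [Subgroup.mul_mem_cancel_right _ (MonoidHom.mem_range.2 ⟨h, rfl⟩)]
          exact hl.1 a (by simp)
      · have := hl.2
        simp only [List.isChain_append, List.isChain_singleton, List.head?_cons, Option.mem_def,
          Option.some.injEq, forall_eq'] at this ⊢
        exact this
    have := syllableLength_letterProd d hl'
    simpa [mul_assoc, of_apply_eq_base] using this

theorem syllableLength_add_branching {r s : List (Σ i, G i)} (hr : IsReducedList φ r)
    (hs : IsReducedList φ s) (hrd : ∀ a ∈ r, a.2 ∈ d.set a.1) (hsd : ∀ a ∈ s, a.2 ∈ d.set a.1) :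
    syllableLength d (letterProd φ r.reverse * (letterProd φ s.reverse)⁻¹) + branching r s =
      r.length + s.length := by
  have of_heads_ne {r s : List (Σ i, G i)} (hr : IsReducedList φ r) (hs : IsReducedList φ s)
      (hrs : ∀ a ∈ r.head?, ∀ b ∈ s.head?, a.1 ≠ b.1) :
      syllableLength d (letterProd φ r.reverse * (letterProd φ s.reverse)⁻¹) =
        r.length + s.length := by
    rw [← letterProd_map_invLetter, ← letterProd_append,
      syllableLength_letterProd d (hr.reverse_append_map_invLetter hs hrs)]
    simp
  induction r generalizing s with
  | nil => simpa [branching] using of_heads_ne hr hs (by simp)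
  | cons a r ih =>
    rcases s with _ | ⟨b, s⟩
    · simpa [branching] using of_heads_ne hr hs (by simp)
    by_cases hab : a = b
    · subst hab
      have := ih hr.of_cons hs.of_cons (fun c hc => hrd c (List.mem_cons_of_mem _ hc))
        fun c hc => hsd c (List.mem_cons_of_mem _ hc)
      simp only [branching, if_true, List.reverse_cons, letterProd_append, mul_inv_rev,
        List.length_cons]
      rw [mul_assoc, mul_inv_cancel_left]
      lia
    by_cases hi : a.1 = b.1
    · obtain ⟨i, a⟩ := a
      obtain ⟨j, b⟩ := b
      obtain rfl : i = j := hi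
      have hr' : IsReducedList φ (⟨i, a * b⁻¹⟩ :: r) := by
        refine ⟨fun c hc => ?_, List.isChain_cons.2 ⟨fun c hc => hr.head_ne hc, hr.of_cons.2⟩⟩
        rcases List.mem_cons.1 hc with rfl | hc
        · intro h
          have := Transversal.eq_of_mul_inv_mem (hrd ⟨i, a⟩ (by simp)) (hsd ⟨i, b⟩ (by simp)) h
          exact hab (by simpa using this)
        · exact hr.of_cons.1 c hc
      have := of_heads_ne hr' hs.of_cons (by
        simp only [List.head?_cons, Option.mem_def, Option.some.injEq, forall_eq']
        exact fun c hc => hs.head_ne hc)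
      simp only [branching, if_neg hab, if_true]
      simp only [List.reverse_cons, letterProd_append, letterProd_cons, letterProd_nil, mul_one,
        map_mul, map_inv, mul_inv_rev, mul_assoc, List.length_cons] at this ⊢
      lia
    · simpa [branching, hab, hi] using of_heads_ne hr hs (by simpa using hi)

/-- Twice the Gromov product based at `1` is the branching of associated lists. -/
theorem exists_list_gromov_product :
    ∃ f : PushoutI φ → List (Σ i, G i), f 1 = [] ∧
      ∀ x y, syllableLength d (x * y⁻¹) + branching (f x) (f y) =
        syllableLength d x + syllableLength d y := by
  choose h l hl hd hprod hlen using exists_normalized_list d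
  refine ⟨fun x => (l x).reverse, ?_, fun x y => ?_⟩
  · have := hlen 1
    rw [← letterProd_nil, syllableLength_letterProd d ⟨by simp, by simp⟩] at this
    simpa using this.symm
  · have := syllableLength_add_branching d (hl x).reverse (hl y).reverse
      (fun a ha => hd x a (List.mem_reverse.1 ha)) fun a ha => hd y a (List.mem_reverse.1 ha)
    simp only [List.reverse_reverse, List.length_reverse] at this
    rw [hlen x, hlen y, ← this, hprod x, hprod y, mul_inv_rev, ← map_inv, ← mul_assoc,
      syllableLength_mul_base, mul_assoc, syllableLength_base_mul, ← hprod x, ← hprod y]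

theorem syllableLength_one : syllableLength d (1 : PushoutI φ) = 0 := by
  simpa using syllableLength_letterProd d (l := []) ⟨by simp, by simp⟩

theorem syllableLength_inv (x : PushoutI φ) : syllableLength d x⁻¹ = syllableLength d x := by
  obtain ⟨f, hf₁, hf⟩ := exists_list_gromov_product d
  simpa [hf₁, branching, syllableLength_one] using hf 1 x

/-- The distance `syllableLength d (x * y⁻¹)` satisfies the four-point condition, i.e. it is
`0`-hyperbolic. -/
theorem syllableLength_four_point (w x y z : PushoutI φ) :
    syllableLength d (x * w⁻¹) + syllableLength d (y * z⁻¹) ≤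
      max (syllableLength d (y * w⁻¹) + syllableLength d (x * z⁻¹))
        (syllableLength d (z * w⁻¹) + syllableLength d (x * y⁻¹)) := by
  obtain ⟨f, -, hf⟩ := exists_list_gromov_product d
  have h₁ := hf (y * w⁻¹) (z * w⁻¹)
  have h₂ := hf (x * w⁻¹) (z * w⁻¹)
  have h₃ := hf (y * w⁻¹) (x * w⁻¹)
  have hxy : syllableLength d (y * x⁻¹) = syllableLength d (x * y⁻¹) := by
    rw [← syllableLength_inv, mul_inv_rev, inv_inv]
  have h₅ := min_branching_le (f (y * w⁻¹)) (f (x * w⁻¹)) (f (z * w⁻¹))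
  simp only [mul_inv_rev, inv_inv, mul_assoc, inv_mul_cancel_left] at h₁ h₂ h₃
  lia

theorem syllableLength_mul_le (x y : PushoutI φ) :
    syllableLength d (x * y) ≤ syllableLength d x + syllableLength d y := by
  obtain ⟨f, -, hf⟩ := exists_list_gromov_product d
  have := hf x y⁻¹
  rw [inv_inv, syllableLength_inv] at this
  lia

theorem syllableLength_of_le {i : ι} (g : G i) : syllableLength d (of i g : PushoutI φ) ≤ 1 := by
  by_cases hg : g ∈ (φ i).range
  · obtain ⟨h, rfl⟩ := hg
    have := syllableLength_base_mul d h 1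
    rw [mul_one, syllableLength_one] at this
    rw [of_apply_eq_base, this]
    exact zero_le
  · have := syllableLength_letterProd (φ := φ) d (l := [⟨i, g⟩]) ⟨by simpa using hg, by simp⟩
    simp only [letterProd_cons, letterProd_nil, mul_one, List.length_singleton] at this
    exact this.le

theorem syllableLength_list_prod_le {L : List (PushoutI φ)}
    (hL : ∀ x ∈ L, ∃ i : ι, x ∈ (of (φ := φ) i).range) :
    syllableLength d L.prod ≤ L.length := by
  induction L with
  | nil => simp [syllableLength_one]
  | cons x L ih =>
    obtain ⟨i, g, rfl⟩ := hL x (by simp)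
    have h₁ := ih fun y hy => hL y (List.mem_cons_of_mem _ hy)
    have h₂ := syllableLength_mul_le d (of i g) L.prod
    have h₃ := syllableLength_of_le (φ := φ) d g
    simp only [List.prod_cons, List.length_cons]
    lia

theorem base_mem_range_of (i : ι) (h : H) : base φ h ∈ (of (φ := φ) i).range :=
  ⟨φ i h, of_apply_eq_base φ i h⟩

theorem mem_range_of_of_syllableLength_eq_zero (i : ι) {x : PushoutI φ}
    (hx : syllableLength d x = 0) : x ∈ (of (φ := φ) i).range := by
  obtain ⟨h, l, -, -, rfl, hlen⟩ := exists_normalized_list d x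
  obtain rfl := List.length_eq_zero_iff.1 (hlen ▸ hx)
  simpa using base_mem_range_of i h

/-- An element of length at most `1` whose product with an element of a factor outside the base
group still has length at most `1` lies in that factor. -/
theorem mem_range_of_of_syllableLength_mul_le_one {i : ι} {g : G i} (hg : g ∉ (φ i).range)
    {x : PushoutI φ} (hx : syllableLength d x ≤ 1)
    (hgx : syllableLength d (of i g * x) ≤ 1) : x ∈ (of (φ := φ) i).range := by
  obtain ⟨h, l, hl, -, rfl, hlen⟩ := exists_normalized_list d x
  rcases l with _ | ⟨a, _ | ⟨b, l⟩⟩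
  · simpa using base_mem_range_of i h
  · obtain ⟨j, a⟩ := a
    by_cases hij : i = j
    · subst hij
      simpa using mul_mem (base_mem_range_of i h) (MonoidHom.mem_range.2 ⟨a, rfl⟩)
    · have := syllableLength_letterProd (φ := φ) d (l := [⟨i, g * φ i h⟩, ⟨j, a⟩]) (by
        refine ⟨?_, by simpa using hij⟩
        simp only [List.mem_cons, List.not_mem_nil, or_false, forall_eq_or_imp, forall_eq]
        refine ⟨?_, hl.1 ⟨j, a⟩ (by simp)⟩
        rwa [Subgroup.mul_mem_cancel_right _ (MonoidHom.mem_range.2 ⟨h, rfl⟩)])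
      simp only [letterProd_cons, letterProd_nil, mul_one, map_mul, of_apply_eq_base,
        List.length_cons, List.length_nil, mul_assoc] at this hgx
      lia
  · simp only [List.length_cons] at hlen
    lia

/-- If `1` and `k` realise the diameter `D` of a subgroup, then translates by the subgroup of points
`u`, `v` near the middle of the segment from `1` to `k` stay close to each other. -/
theorem syllableLength_mul_mul_inv_add_le {K : Subgroup (PushoutI φ)} {k : PushoutI φ}
    (hk : k ∈ K) (hmax : ∀ k' ∈ K, syllableLength d k' ≤ syllableLength d k)
    {u v : PushoutI φ} {a b : ℕ}
    (hu : syllableLength d u ≤ a) (hku : syllableLength d (k * u⁻¹) ≤ a)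
    (hv : syllableLength d v ≤ b) (hkv : syllableLength d (k * v⁻¹) ≤ b)
    {k' : PushoutI φ} (hk' : k' ∈ K) :
    syllableLength d (v * k' * u⁻¹) + syllableLength d k ≤ a + b := by
  have swap (x y : PushoutI φ) : syllableLength d (x * y⁻¹) = syllableLength d (y * x⁻¹) := by
    rw [← syllableLength_inv, mul_inv_rev, inv_inv]
  have hk'' := inv_mem hk'
  have near_one := syllableLength_four_point d 1 (u * k'⁻¹) k'⁻¹ (k * k'⁻¹)
  have near_k := syllableLength_four_point d k (u * k'⁻¹) k'⁻¹ (k * k'⁻¹)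
  have near := syllableLength_four_point d (u * k'⁻¹) v 1 k
  have h₁ := hmax _ hk'
  have h₂ := hmax _ (mul_mem hk hk'')
  have h₃ := hmax _ (mul_mem hk'' (inv_mem hk))
  have h₄ := hmax _ (mul_mem (mul_mem hk hk'') (inv_mem hk))
  rw [swap] at hku hkv
  rw [swap k (u * k'⁻¹), swap 1 (u * k'⁻¹)] at near
  simp only [inv_one, mul_one, one_mul, mul_inv_rev, inv_inv, mul_assoc, inv_mul_cancel_left,
    inv_mul_cancel, syllableLength_inv] at near_one near_k near h₃ h₄ ⊢
  lia

end Monoid.PushoutI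

open Monoid.PushoutI

/-- **Serre's theorem on subgroups of bounded length in an amalgam.**
Let `H` be a group, `(G i)` a family of groups indexed by a nonempty type `ι`,
and `φ i : H →* G i` injective homomorphisms; let `Monoid.PushoutI φ` be the
amalgamated free product, with canonical injections `Monoid.PushoutI.of i : G i →* PushoutI φ`.
If `K` is a subgroup of bounded length, i.e. there is `N` such that every element of `K` is a
product of at most `N` elements each lying in the image of some `of i`, then `K` is contained
in a conjugate of one of the factors. -/
theorem serre_bounded_length_subgroup_conjugate_into_factor
    {ι : Type*} [Nonempty ι] {H : Type*} [Group H] {G : ι → Type*} [∀ i, Group (G i)]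
    (φ : ∀ i, H →* G i) (hφ : ∀ i, Function.Injective (φ i))
    (K : Subgroup (Monoid.PushoutI φ))
    (hbdd : ∃ N : ℕ, ∀ k ∈ K, ∃ L : List (Monoid.PushoutI φ),
      L.length ≤ N ∧ (∀ x ∈ L, ∃ i : ι, x ∈ (Monoid.PushoutI.of (φ := φ) i).range) ∧
      L.prod = k) :
    ∃ (g : Monoid.PushoutI φ) (i : ι),
      ∀ k ∈ K, g⁻¹ * k * g ∈ (Monoid.PushoutI.of (φ := φ) i).range := by
  obtain ⟨d⟩ := NormalWord.transversal_nonempty φ hφ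
  obtain ⟨k, hk, hmax⟩ : ∃ k ∈ K, ∀ k' ∈ K, syllableLength d k' ≤ syllableLength d k := by
    obtain ⟨N, hN⟩ := hbdd
    have hbdd' : BddAbove (syllableLength d '' (K : Set (Monoid.PushoutI φ))) := by
      refine ⟨N, ?_⟩
      rintro _ ⟨k, hk, rfl⟩
      obtain ⟨L, hLN, hL, rfl⟩ := hN k hk
      exact (syllableLength_list_prod_le d hL).trans hLN
    obtain ⟨k, hk, hkmax⟩ := Nat.sSup_mem (Set.Nonempty.image _ ⟨1, K.one_mem⟩) hbdd'
    exact ⟨k, hk, fun k' hk' => hkmax ▸ le_csSup hbdd' ⟨k', hk', rfl⟩⟩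
  obtain ⟨h, l, hl, -, hkl, hlen⟩ := exists_normalized_list d k
  obtain ⟨m, hm | hm⟩ := Nat.even_or_odd' l.length
  · obtain ⟨l₁, l₂, rfl, hl₁, hl₂⟩ : ∃ l₁ l₂, l = l₁ ++ l₂ ∧ l₁.length = m ∧ l₂.length = m :=
      ⟨l.take m, l.drop m, by simp, by simp; lia, by simp; lia⟩
    have hp : syllableLength d (letterProd φ l₂) ≤ m := by
      rw [syllableLength_letterProd d hl.of_append_right, hl₂]
    have hkp : syllableLength d (k * (letterProd φ l₂)⁻¹) ≤ m := by
      rw [hkl, letterProd_append, ← mul_assoc, mul_inv_cancel_right,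
        syllableLength_base_mul_letterProd d h hl.of_append_left, hl₁]
    refine ⟨(letterProd φ l₂)⁻¹, Classical.arbitrary ι, fun k' hk' => ?_⟩
    refine mem_range_of_of_syllableLength_eq_zero d _ ?_
    have := syllableLength_mul_mul_inv_add_le d hk hmax hp hkp hp hkp hk'
    rw [inv_inv]
    lia
  · obtain ⟨l₁, c, l₂, rfl, hl₁, hl₂⟩ :
        ∃ l₁ c l₂, l = l₁ ++ c :: l₂ ∧ l₁.length = m ∧ l₂.length = m :=
      ⟨l.take m, l[m], l.drop (m + 1), by simp, by simp; lia, by simp; lia⟩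
    have hp : syllableLength d (letterProd φ l₂) ≤ m + 1 := by
      rw [syllableLength_letterProd d hl.of_append_right.of_cons, hl₂]
      lia
    have hkp : syllableLength d (k * (letterProd φ l₂)⁻¹) ≤ m + 1 := by
      rw [List.append_cons] at hkl hl
      rw [hkl, letterProd_append, ← mul_assoc, mul_inv_cancel_right,
        syllableLength_base_mul_letterProd d h hl.of_append_left]
      simp [hl₁]
    have hq : syllableLength d (letterProd φ (c :: l₂)) ≤ m + 1 := by
      rw [syllableLength_letterProd d hl.of_append_right, List.length_cons, hl₂]
    have hkq : syllableLength d (k * (letterProd φ (c :: l₂))⁻¹) ≤ m + 1 := by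
      rw [hkl, letterProd_append, ← mul_assoc, mul_inv_cancel_right,
        syllableLength_base_mul_letterProd d h hl.of_append_left]
      lia
    refine ⟨(letterProd φ l₂)⁻¹, c.1, fun k' hk' => ?_⟩
    have h₁ := syllableLength_mul_mul_inv_add_le d hk hmax hp hkp hp hkp hk'
    have h₂ := syllableLength_mul_mul_inv_add_le d hk hmax hp hkp hq hkq hk'
    refine mem_range_of_of_syllableLength_mul_le_one d (hl.1 c (by simp)) ?_ ?_
    · rw [inv_inv]
      lia
    · simp only [letterProd_cons, mul_assoc, inv_inv] at h₂ ⊢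
      lia
end

section
/- Let K be an uncountable algebraically closed field of characteristic zero, let E ⊆ Kⁿ be a Zariski-closed set, and let A_1 ⊆ A_2 ⊆ … be an increasing sequence of constructible subsets of Kⁿ such that E = ⋃_{i∈ℕ} A_i. Then E ⊆ A_k for some k ∈ ℕ. -/
open Cardinal in
/-- A field extension of countable degree of an uncountable field is algebraic. -/
theorem Algebra.isAlgebraic_of_rank_le_aleph0 {K L : Type*} [Field K] [Uncountable K]
    [Field L] [Algebra K L] (h : Module.rank K L ≤ ℵ₀) : Algebra.IsAlgebraic K L := by
  refine ⟨fun x ↦ ?_⟩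
  by_contra hx
  have hle := (show Transcendental K x from hx).linearIndependent_sub_inv.cardinal_lift_le_rank
  have hK : #K ≤ ℵ₀ := by
    rw [← lift_le_aleph0]
    exact hle.trans (lift_le_aleph0.2 h)
  exact not_countable (mk_le_aleph0_iff.1 hK)

/-- A field extension of countable degree of an uncountable algebraically closed field admits a
retraction. -/
theorem IsAlgClosed.nonempty_algHom_of_rank_le_aleph0 {K L : Type*} [Field K] [IsAlgClosed K]
    [Uncountable K] [Field L] [Algebra K L] (h : Module.rank K L ≤ Cardinal.aleph0) :
    Nonempty (L →ₐ[K] K) :=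
  have := Algebra.isAlgebraic_of_rank_le_aleph0 h
  ⟨IsAlgClosed.lift⟩

/-- Weak Nullstellensatz in countably many variables over an uncountable field. -/
theorem MvPolynomial.exists_forall_mem_eval_eq_zero {K τ : Type*} [Field K] [IsAlgClosed K]
    [Uncountable K] [Countable τ] {I : Ideal (MvPolynomial τ K)} (hI : I ≠ ⊤) :
    ∃ x : τ → K, ∀ p ∈ I, eval x p = 0 := by
  obtain ⟨M, hM, hIM⟩ := I.exists_le_maximal hI
  let : Field (MvPolynomial τ K ⧸ M) := Ideal.Quotient.field M
  have hrank : Module.rank K (MvPolynomial τ K ⧸ M) ≤ Cardinal.aleph0 := by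
    refine (LinearMap.rank_le_of_surjective (Ideal.Quotient.mkₐ K M).toLinearMap
      (Ideal.Quotient.mkₐ_surjective K M)).trans ?_
    rw [rank_eq_lift, Cardinal.lift_le_aleph0]
    exact Cardinal.mk_le_aleph0
  obtain ⟨φ⟩ := IsAlgClosed.nonempty_algHom_of_rank_le_aleph0 hrank
  refine ⟨fun s ↦ φ (Ideal.Quotient.mkₐ K M (X s)), fun p hp ↦ ?_⟩
  have key : aeval (fun s ↦ φ (Ideal.Quotient.mkₐ K M (X s))) =
      φ.comp (Ideal.Quotient.mkₐ K M) := by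
    ext; simp
  rw [← coe_aeval_eq_eval, RingHom.coe_coe, key, AlgHom.comp_apply, Ideal.Quotient.mkₐ_eq_mk,
    Ideal.Quotient.eq_zero_iff_mem.2 (hIM hp), map_zero]

/-- An irreducible variety over an uncountable algebraically closed field is not covered by
countably many hypersurfaces not containing it. -/
theorem MvPolynomial.exists_mem_zeroLocus_forall_eval_ne_zero {K σ ι : Type*} [Field K]
    [IsAlgClosed K] [Uncountable K] [Countable σ] [Countable ι]
    (P : Ideal (MvPolynomial σ K)) [P.IsPrime] (f : ι → MvPolynomial σ K)
    (hf : ∀ i, f i ∉ P) :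
    ∃ x : σ → K, (∀ p ∈ P, eval x p = 0) ∧ ∀ i, eval x (f i) ≠ 0 := by
  let F := FractionRing (MvPolynomial σ K ⧸ P)
  let ψ : MvPolynomial σ K →ₐ[K] F :=
    (IsScalarTower.toAlgHom K (MvPolynomial σ K ⧸ P) F).comp (Ideal.Quotient.mkₐ K P)
  have hψ (p) : ψ p = 0 ↔ p ∈ P := by
    rw [← Ideal.Quotient.eq_zero_iff_mem]
    exact map_eq_zero_iff _ (IsFractionRing.injective (MvPolynomial σ K ⧸ P) F)
  let Φ : MvPolynomial (σ ⊕ ι) K →ₐ[K] F :=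
    aeval (Sum.elim (fun s ↦ ψ (X s)) fun i ↦ (ψ (f i))⁻¹)
  have hΦ (p) : Φ (rename Sum.inl p) = ψ p := by
    have : Φ.comp (rename Sum.inl) = ψ := by ext; simp [Φ]
    exact DFunLike.congr_fun this p
  obtain ⟨x, hx⟩ := exists_forall_mem_eval_eq_zero (RingHom.ker_ne_top Φ.toRingHom)
  refine ⟨x ∘ Sum.inl, fun p hp ↦ ?_, fun i h0 ↦ ?_⟩
  · rw [← eval_rename]
    exact hx _ ((hΦ p).trans ((hψ p).2 hp))
  · have hmem : rename Sum.inl (f i) * X (Sum.inr i) - 1 ∈ RingHom.ker Φ.toRingHom := by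
      have hne : ψ (f i) ≠ 0 := fun h ↦ hf i ((hψ _).1 h)
      change Φ _ = 0
      rw [map_sub, map_mul, hΦ, map_one]
      rw [aeval_X, Sum.elim_inr]
      exact sub_eq_zero.2 (mul_inv_cancel₀ hne)
    have := hx _ hmem
    rw [map_sub, map_mul, eval_rename, h0] at this
    simp at this


/-- A subset of `Kⁿ` is Zariski-closed if it is the common zero locus of a set of
polynomials in `K[x_1,…,x_n]`. -/
def ZariskiClosed {K : Type*} [CommRing K] {n : ℕ} (S : Set (Fin n → K)) : Prop :=
  ∃ I : Set (MvPolynomial (Fin n) K),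
    S = {x : Fin n → K | ∀ p ∈ I, MvPolynomial.eval x p = 0}

/-- A subset of `Kⁿ` is constructible if it is a finite union of sets of the form
`Z \ Z'` with `Z`, `Z'` Zariski-closed. -/
def ZariskiConstructible {K : Type*} [CommRing K] {n : ℕ} (S : Set (Fin n → K)) : Prop :=
  ∃ (m : ℕ) (Z Z' : Fin m → Set (Fin n → K)),
    (∀ j, ZariskiClosed (Z j) ∧ ZariskiClosed (Z' j)) ∧ S = ⋃ j, Z j \ Z' j

/-- Over an uncountable algebraically closed field of characteristic zero, if a
Zariski-closed set `E ⊆ Kⁿ` is the union of an increasing sequence of constructible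
subsets `A_1 ⊆ A_2 ⊆ …`, then `E ⊆ A_k` for some `k`. -/
theorem zariskiClosed_subset_of_iUnion_constructible
    {K : Type*} [Field K] [IsAlgClosed K] [CharZero K] [Uncountable K] {n : ℕ}
    (E : Set (Fin n → K)) (hE : ZariskiClosed E)
    (A : ℕ → Set (Fin n → K)) (hmono : ∀ i, A i ⊆ A (i + 1))
    (hconstr : ∀ i, ZariskiConstructible (A i))
    (hcover : E = ⋃ i : ℕ, A i) :
    ∃ k : ℕ, E ⊆ A k := by
  have hA : Monotone A := monotone_nat_of_le_succ hmono
  choose m Z Z' hZ hAZ using hconstr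
  choose I hI using fun i j ↦ (hZ i j).1
  choose I' hI' using fun i j ↦ (hZ i j).2
  have key : ∀ J : Ideal (MvPolynomial (Fin n) K),
      {x : Fin n → K | ∀ p ∈ J, MvPolynomial.eval x p = 0} ⊆ ⋃ i, A i →
      ∃ k, {x : Fin n → K | ∀ p ∈ J, MvPolynomial.eval x p = 0} ⊆ A k := by
    intro J
    induction J using WellFoundedGT.induction with
    | ind J ih =>
    intro hJ
    have ih' (S : Set (MvPolynomial (Fin n) K)) (hS : ¬ S ⊆ J) :
        ∃ k, ∀ x : Fin n → K, (∀ p ∈ J, MvPolynomial.eval x p = 0) →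
          (∀ p ∈ S, MvPolynomial.eval x p = 0) → x ∈ A k := by
      obtain ⟨k, hk⟩ := ih (J ⊔ Ideal.span S)
        (left_lt_sup.2 fun h ↦ hS (Ideal.span_le.1 h))
        (fun x hx ↦ hJ fun p hp ↦ hx p (Ideal.mem_sup_left hp))
      refine ⟨k, fun x hxJ hxS ↦ hk ?_⟩
      have : J ⊔ Ideal.span S ≤ RingHom.ker (MvPolynomial.eval x) :=
        sup_le hxJ (Ideal.span_le.2 hxS)
      exact fun p hp ↦ this hp
    by_cases hP : J.IsPrime
    · obtain ⟨i, j, hij, hij'⟩ : ∃ i j, I i j ⊆ J ∧ ¬ I' i j ⊆ J := by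
        by_contra! hcon
        have hf (a : Σ i, Fin (m i)) : ∃ f, f ∉ J ∧ (f ∈ I a.1 a.2 ∨ I' a.1 a.2 ⊆ J) := by
          by_cases h : I a.1 a.2 ⊆ J
          · exact ⟨1, J.ne_top_iff_one.1 hP.ne_top, .inr (hcon _ _ h)⟩
          · obtain ⟨f, hfI, hfJ⟩ := Set.not_subset.1 h
            exact ⟨f, hfJ, .inl hfI⟩
        choose f hfJ hf using hf
        obtain ⟨x, hxJ, hxf⟩ :=
          MvPolynomial.exists_mem_zeroLocus_forall_eval_ne_zero J f hfJ
        obtain ⟨i, hi⟩ := Set.mem_iUnion.1 (hJ hxJ)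
        rw [hAZ i] at hi
        obtain ⟨j, hj, hj'⟩ := Set.mem_iUnion.1 hi
        rw [hI] at hj
        rw [hI'] at hj'
        rcases hf ⟨i, j⟩ with h | h
        · exact hxf ⟨i, j⟩ (hj _ h)
        · exact hj' fun p hp ↦ hxJ p (h hp)
      obtain ⟨k, hk⟩ := ih' _ hij'
      refine ⟨max i k, fun x hx ↦ ?_⟩
      by_cases hx' : x ∈ Z' i j
      · rw [hI'] at hx'
        exact hA (le_max_right i k) (hk x hx hx')
      · refine hA (le_max_left i k) ?_
        rw [hAZ i]
        refine Set.mem_iUnion.2 ⟨j, ?_, hx'⟩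
        rw [hI]
        exact fun p hp ↦ hx p (hij hp)
    · rcases J.not_isPrime_iff.1 hP with rfl | ⟨a, ha, b, hb, hab⟩
      · exact ⟨0, fun x hx ↦ absurd (hx 1 trivial) (by simp)⟩
      · obtain ⟨k, hk⟩ := ih' {a} (by simpa using ha)
        obtain ⟨l, hl⟩ := ih' {b} (by simpa using hb)
        refine ⟨max k l, fun x hx ↦ ?_⟩
        have h := hx _ hab
        rw [map_mul, mul_eq_zero] at h
        rcases h with h | h
        · exact hA (le_max_left k l) (hk x hx (by simpa using h))
        · exact hA (le_max_right k l) (hl x hx (by simpa using h))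
  obtain ⟨S, hS⟩ := hE
  have hES : E = {x : Fin n → K | ∀ p ∈ Ideal.span S, MvPolynomial.eval x p = 0} := by
    rw [hS]
    ext x
    exact (Ideal.span_le (I := RingHom.ker (MvPolynomial.eval x))).symm
  rw [hES]
  exact key _ (hES ▸ hcover.subset)
end

section
/- Let K be an algebraically closed field of characteristic zero. Every K-algebra automorphism of the mixed ring K[x, y^{±1}] is of the form y ↦ c·y^ε, x ↦ u·y^m·x + p(y), with c, u ∈ K^×, ε ∈ {1, −1}, m ∈ ℤ, and p(y) ∈ K[y, y^{-1}]; conversely each such assignment defines a K-algebra automorphism. Consequently, the automorphism group of K[x, y^{±1}] is isomorphic to (U ⋊ T) ⋊ (ℤ ⋊ ℤ/2ℤ), where U is the additive group of K[y, y^{-1}] acting by translations x ↦ x + p(y), T ≅ (K^×)² acts by x ↦ t₁·x, y ↦ t₂·y, the factor ℤ is generated by x ↦ x·y, y ↦ y, the factor ℤ/2ℤ is generated by x ↦ x, y ↦ y^{-1}, and the semidirect product structures are given by conjugation inside the automorphism group. -/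
open Polynomial LaurentPolynomial

section SemidirectProduct

variable {N H G : Type*} [Group N] [Group H] [Group G]

/-- If `f : N →* G` is injective and its range is normalized by the range of `g : H →* G`, then
conjugation by `g` defines an action of `H` on `N`. -/
theorem MonoidHom.exists_mulAut_of_normalizes (f : N →* G) (g : H →* G)
    (hf : Function.Injective f) (hfg : ∀ h n, ∃ n', g h * f n = f n' * g h) :
    ∃ φ : H →* MulAut N, ∀ h n, f (φ h n) = g h * f n * (g h)⁻¹ := by
  have hconj : ∀ h n, ∃ n', f n' = g h * f n * (g h)⁻¹ := fun h n ↦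
    (hfg h n).imp fun n' hn' ↦ by rw [hn', mul_inv_cancel_right]
  choose c hc using hconj
  refine ⟨MonoidHom.mk' (fun h ↦ MulEquiv.mk' ⟨c h, c h⁻¹, fun n ↦ hf ?_, fun n ↦ hf ?_⟩
    fun m n ↦ hf ?_) fun h k ↦ MulEquiv.ext fun n ↦ hf ?_, hc⟩
  · simp only [hc, map_inv]; group
  · simp only [hc, map_inv]; group
  · simp only [Equiv.coe_fn_mk, hc, map_mul]; group
  · change f (c _ n) = f (c h (c k n))
    simp only [hc, map_mul]; group

/-- Recognition of internal semidirect products. -/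
theorem SemidirectProduct.exists_hom_injective (f : N →* G) (g : H →* G)
    (hf : Function.Injective f)
    (hfg : ∀ h n, ∃ n', g h * f n = f n' * g h) (hdisj : ∀ n h, f n = g h → h = 1) :
    ∃ (φ : H →* MulAut N) (F : N ⋊[φ] H →* G), Function.Injective F ∧
      (∀ n, F (inl n) = f n) ∧ (∀ h, F (inr h) = g h) ∧ ∀ x, F x = f x.left * g x.right := by
  obtain ⟨φ, hφ⟩ := f.exists_mulAut_of_normalizes g hf hfg
  refine ⟨φ, lift f g fun h ↦ MonoidHom.ext fun n ↦ hφ h n, ?_, lift_inl _ _ _, lift_inr _ _ _,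
    fun x ↦ rfl⟩
  refine (injective_iff_map_eq_one _).2 fun x hx ↦ ?_
  replace hx : f x.left * g x.right = 1 := hx
  have hr : x.right = 1 := inv_eq_one.1 (hdisj x.left _ (by rw [map_inv, eq_inv_iff_mul_eq_one, hx]))
  rw [hr, map_one, mul_one] at hx
  exact SemidirectProduct.ext ((injective_iff_map_eq_one f).1 hf _ hx) hr

end SemidirectProduct

namespace LaurentPolynomial

variable {K : Type*} [Field K]

/-- The invertible Laurent monomial `c * T n`. -/
noncomputable def unitMonomial (c : Kˣ) (n : ℤ) : K[T;T⁻¹]ˣ where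
  val := C (c : K) * T n
  inv := C ((c⁻¹ : Kˣ) : K) * T (-n)
  val_inv := by
    rw [mul_mul_mul_comm, ← map_mul, ← T_add]; simp
  inv_val := by
    rw [mul_mul_mul_comm, ← map_mul, ← T_add]; simp

@[simp]
theorem val_unitMonomial (c : Kˣ) (n : ℤ) : (unitMonomial c n : K[T;T⁻¹]) = C (c : K) * T n := rfl

theorem unitMonomial_mul (c d : Kˣ) (m n : ℤ) :
    unitMonomial c m * unitMonomial d n = unitMonomial (c * d) (m + n) := by
  ext1
  simp only [Units.val_mul, val_unitMonomial, map_mul, T_add]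
  ring

@[simp]
theorem unitMonomial_one_zero : unitMonomial (1 : Kˣ) 0 = 1 := by ext1; simp

theorem unitMonomial_zpow (c : Kˣ) (m k : ℤ) :
    unitMonomial c m ^ k = unitMonomial (c ^ k) (m * k) := by
  induction k with
  | zero => simp
  | succ k ih => rw [zpow_add_one, ih, unitMonomial_mul, zpow_add_one, mul_add_one]
  | pred k ih =>
    rw [zpow_sub_one, ih, mul_inv_eq_iff_eq_mul, unitMonomial_mul, zpow_sub_one]
    simp [mul_sub]

theorem unitMonomial_inj {c d : Kˣ} {m n : ℤ} :
    unitMonomial c m = unitMonomial d n ↔ c = d ∧ m = n := by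
  refine ⟨fun h ↦ ?_, fun ⟨h₁, h₂⟩ ↦ h₁ ▸ h₂ ▸ rfl⟩
  replace h : C (c : K) * T m = C (d : K) * T n := congrArg Units.val h
  have hmn : m = n := by
    have := congrArg degree h
    rwa [degree_C_mul_T _ _ c.ne_zero, degree_C_mul_T _ _ d.ne_zero, WithBot.coe_inj] at this
  subst hmn
  have hC := (isUnit_T (R := K) m).mul_right_cancel h
  refine ⟨Units.ext ?_, rfl⟩
  simpa using congrArg (fun p : K[T;T⁻¹] ↦ p.coeff 0) hC

theorem exists_unitMonomial_eq (v : K[T;T⁻¹]ˣ) : ∃ c n, v = unitMonomial c n := by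
  obtain ⟨n, p, hp⟩ := exists_T_pow (v : K[T;T⁻¹])
  obtain ⟨m, q, hq⟩ := exists_T_pow ((v⁻¹ : K[T;T⁻¹]ˣ) : K[T;T⁻¹])
  have hpq : p * q = Polynomial.X ^ (n + m) := by
    apply Polynomial.toLaurent_injective
    rw [map_mul, hp, hq, Polynomial.toLaurent_X_pow, mul_mul_mul_comm, Units.mul_inv, one_mul,
      ← T_add, Nat.cast_add]
  obtain ⟨k, -, u, hu⟩ := (dvd_prime_pow Polynomial.prime_X _).1 (Dvd.intro _ hpq)
  obtain ⟨c, hc, hcu⟩ := Polynomial.isUnit_iff.1 u⁻¹.isUnit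
  have hpk : p = Polynomial.C c * Polynomial.X ^ k := by
    rw [hcu, ← hu, mul_comm, Units.mul_inv_cancel_right]
  refine ⟨hc.unit, k - n, Units.ext ?_⟩
  rw [hpk, Polynomial.toLaurent_C_mul_X_pow] at hp
  rw [val_unitMonomial, IsUnit.unit_spec, T_sub, ← mul_assoc, hp, mul_assoc, ← T_add]
  simp

theorem algHom_ext_T {A : Type*} [Semiring A] [Algebra K A] {f g : K[T;T⁻¹] →ₐ[K] A}
    (h : f (T 1) = g (T 1)) : f = g := by
  refine AddMonoidAlgebra.algHom_ext' (MonoidHom.ext_mint (M := A) h) (by ext)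

/-- The endomorphism of `K[T;T⁻¹]` sending `T` to the unit `v`. -/
noncomputable def endOfUnit (v : K[T;T⁻¹]ˣ) : K[T;T⁻¹] →ₐ[K] K[T;T⁻¹] :=
  { eval₂ C v with commutes' := fun r ↦ eval₂_C C v r }

theorem endOfUnit_C_mul_T (v : K[T;T⁻¹]ˣ) (r : K) (n : ℤ) :
    endOfUnit v (C r * T n) = C r * (v ^ n : K[T;T⁻¹]ˣ) :=
  eval₂_C_mul_T C v r n

theorem endOfUnit_unitMonomial (c u : Kˣ) (k m : ℤ) :
    endOfUnit (unitMonomial c k) (unitMonomial u m) = unitMonomial (c ^ m * u) (k * m) := by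
  rw [val_unitMonomial, endOfUnit_C_mul_T, unitMonomial_zpow]
  simp only [val_unitMonomial, Units.val_mul, map_mul]
  ring

theorem T_one_eq_unitMonomial : (T 1 : K[T;T⁻¹]) = unitMonomial (1 : Kˣ) 1 := by simp

/-- The automorphism of `K[T;T⁻¹]` sending `T` to `c * T ^ ε`, for `ε = ±1`. -/
noncomputable def monomialAut (c : Kˣ) (ε : ℤˣ) : K[T;T⁻¹] ≃ₐ[K] K[T;T⁻¹] :=
  AlgEquiv.ofAlgHom (endOfUnit (unitMonomial c ε)) (endOfUnit (unitMonomial (c ^ (-ε : ℤ)) ε))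
    (algHom_ext_T <| by
      simp [T_one_eq_unitMonomial, endOfUnit_unitMonomial, -val_unitMonomial])
    (algHom_ext_T <| by
      simp [T_one_eq_unitMonomial, endOfUnit_unitMonomial, -val_unitMonomial, ← zpow_mul])

theorem monomialAut_unitMonomial (c u : Kˣ) (ε : ℤˣ) (m : ℤ) :
    monomialAut c ε (unitMonomial u m) = unitMonomial (c ^ m * u) (ε * m) :=
  endOfUnit_unitMonomial c u ε m

theorem map_monomialAut_unitMonomial (c u : Kˣ) (ε : ℤˣ) (m : ℤ) :
    Units.map (monomialAut c ε : K[T;T⁻¹] →* K[T;T⁻¹]) (unitMonomial u m) =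
      unitMonomial (c ^ m * u) (ε * m) :=
  Units.ext (monomialAut_unitMonomial c u ε m)

theorem monomialAut_T_one (c : Kˣ) (ε : ℤˣ) : monomialAut c ε (T 1) = unitMonomial c ε := by
  rw [T_one_eq_unitMonomial, monomialAut_unitMonomial]; simp

theorem algEquiv_ext_T {f g : K[T;T⁻¹] ≃ₐ[K] K[T;T⁻¹]} (h : f (T 1) = g (T 1)) : f = g :=
  AlgEquiv.ext fun p ↦ DFunLike.congr_fun
    (algHom_ext_T (f := (f : K[T;T⁻¹] →ₐ[K] K[T;T⁻¹])) (g := g) h) p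

theorem monomialAut_mul (c d : Kˣ) (ε δ : ℤˣ) :
    monomialAut c ε * monomialAut d δ = monomialAut (c ^ (δ : ℤ) * d) (ε * δ) := by
  apply algEquiv_ext_T
  rw [AlgEquiv.mul_apply, monomialAut_T_one, monomialAut_unitMonomial, monomialAut_T_one,
    Units.val_mul]

@[simp]
theorem monomialAut_one_one : monomialAut (1 : Kˣ) 1 = 1 := by
  apply algEquiv_ext_T
  rw [monomialAut_T_one]
  simp

theorem monomialAut_inj {c d : Kˣ} {ε δ : ℤˣ} :
    monomialAut c ε = monomialAut d δ ↔ c = d ∧ ε = δ := by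
  refine ⟨fun h ↦ ?_, fun ⟨h₁, h₂⟩ ↦ h₁ ▸ h₂ ▸ rfl⟩
  have := DFunLike.congr_fun h (T 1)
  rw [monomialAut_T_one, monomialAut_T_one, Units.val_inj, unitMonomial_inj, Units.val_inj] at this
  exact this

end LaurentPolynomial

namespace Polynomial

variable {K R : Type*} [CommSemiring K] [CommRing R] [Algebra K R]

/-- The automorphism of `R[X]` acting on coefficients by `σ` and sending `X` to `a * X + b`. -/
noncomputable def affineAut (σ : R ≃ₐ[K] R) (a : Rˣ) (b : R) : R[X] ≃ₐ[K] R[X] :=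
  letI := a.invertible
  (mapAlgEquiv σ).trans ((algEquivCMulXAddC (a : R) b).restrictScalars K)

@[simp]
theorem affineAut_C (σ : R ≃ₐ[K] R) (a : Rˣ) (b r : R) : affineAut σ a b (C r) = C (σ r) := by
  simp [affineAut]

@[simp]
theorem affineAut_X (σ : R ≃ₐ[K] R) (a : Rˣ) (b : R) :
    affineAut σ a b X = C (a : R) * X + C b := by
  simp [affineAut]

theorem algEquiv_ext_C_X {f g : R[X] ≃ₐ[K] R[X]} (hC : ∀ r, f (C r) = g (C r)) (hX : f X = g X) :
    f = g :=
  AlgEquiv.ext fun p ↦ RingHom.congr_fun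
    (ringHom_ext (f := (f : R[X] →+* R[X])) (g := (g : R[X] →+* R[X])) hC hX) p

theorem affineAut_mul (σ τ : R ≃ₐ[K] R) (a a' : Rˣ) (b b' : R) :
    affineAut σ a b * affineAut τ a' b' =
      affineAut (σ * τ) (a * Units.map (σ : R →* R) a') (σ a' * b + σ b') := by
  refine algEquiv_ext_C_X (fun r ↦ by simp) ?_
  simp only [AlgEquiv.mul_apply, affineAut_X, map_add, map_mul, affineAut_C, Units.val_mul]
  simp only [Units.coe_map, MonoidHom.coe_coe]
  ring

@[simp]
theorem affineAut_one : affineAut (1 : R ≃ₐ[K] R) 1 0 = 1 :=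
  algEquiv_ext_C_X (by simp) (by simp)

theorem affineAut_inj {σ τ : R ≃ₐ[K] R} {a a' : Rˣ} {b b' : R} :
    affineAut σ a b = affineAut τ a' b' ↔ σ = τ ∧ a = a' ∧ b = b' := by
  refine ⟨fun h ↦ ⟨AlgEquiv.ext fun r ↦ C_injective ?_, Units.ext ?_, ?_⟩, ?_⟩
  · simpa using DFunLike.congr_fun h (C r)
  · simpa using congrArg (coeff · 1) (DFunLike.congr_fun h X)
  · simpa using congrArg (coeff · 0) (DFunLike.congr_fun h X)
  · rintro ⟨rfl, rfl, rfl⟩; rfl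

/-- An automorphism of `R[X]` over a domain `R` sends `X` to a linear polynomial with invertible
leading coefficient. -/
theorem exists_algEquiv_X_eq [IsDomain R] (φ : R[X] ≃ₐ[R] R[X]) :
    ∃ (a : Rˣ) (b : R), φ X = C (a : R) * X + C b := by
  have hcomp : (φ.symm X).comp (φ X) = X := by
    rw [comp_eq_aeval, ← AlgEquiv.coe_toAlgHom, aeval_algHom_apply, aeval_X_left_apply,
      AlgEquiv.coe_toAlgHom, φ.apply_symm_apply]
  have hdeg : (φ.symm X).natDegree * (φ X).natDegree = 1 := by
    rw [← natDegree_comp, hcomp, natDegree_X]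
  have hdegX : (φ X).natDegree = 1 := Nat.eq_one_of_mul_eq_one_left hdeg
  have hunit : IsUnit ((φ X).coeff 1) := by
    have h := leadingCoeff_comp (p := φ.symm X) (q := φ X) (by rw [hdegX]; exact one_ne_zero)
    rw [hcomp, leadingCoeff_X, Nat.eq_one_of_mul_eq_one_right hdeg, pow_one, mul_comm] at h
    simpa only [leadingCoeff, hdegX] using IsUnit.of_mul_eq_one _ h.symm
  exact ⟨hunit.unit, _, eq_X_add_C_of_natDegree_le_one hdegX.le⟩

theorem exists_eq_affineAut [IsDomain R] (φ : R[X] ≃ₐ[K] R[X]) (σ : R ≃ₐ[K] R)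
    (hφ : ∀ r, φ (C r) = C (σ r)) : ∃ (a : Rˣ) (b : R), φ = affineAut σ a b := by
  obtain ⟨a, b, h⟩ := exists_algEquiv_X_eq <| AlgEquiv.ofRingEquiv
    (f := ((φ * affineAut σ.symm 1 0 : R[X] ≃ₐ[K] R[X]) : R[X] ≃+* R[X])) (R := R)
    fun r ↦ by simp [hφ]
  exact ⟨a, b, algEquiv_ext_C_X (by simp [hφ]) (by simpa using h)⟩

end Polynomial

namespace LaurentPolynomial

variable {K : Type*} [Field K]

theorem exists_algEquiv_C_T_eq (φ : K[T;T⁻¹][X] ≃ₐ[K] K[T;T⁻¹][X]) :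
    ∃ (c : Kˣ) (n : ℤ), φ (Polynomial.C (T 1)) = Polynomial.C (unitMonomial c n : K[T;T⁻¹]) := by
  obtain ⟨r, hr, hφ⟩ := Polynomial.isUnit_iff.1 (((isUnit_T (R := K) 1).map Polynomial.C).map φ)
  obtain ⟨c, n, h⟩ := exists_unitMonomial_eq hr.unit
  exact ⟨c, n, by rw [← h, IsUnit.unit_spec, hφ]⟩

theorem algEquiv_C_eq_of_C_T_eq (φ : K[T;T⁻¹][X] ≃ₐ[K] K[T;T⁻¹][X]) (v : K[T;T⁻¹]ˣ)
    (h : φ (Polynomial.C (T 1)) = Polynomial.C (v : K[T;T⁻¹])) (r : K[T;T⁻¹]) :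
    φ (Polynomial.C r) = Polynomial.C (endOfUnit v r) := by
  refine DFunLike.congr_fun (algHom_ext_T
    (f := (φ : K[T;T⁻¹][X] →ₐ[K] K[T;T⁻¹][X]).comp (IsScalarTower.toAlgHom K _ _))
    (g := (IsScalarTower.toAlgHom K _ _).comp (endOfUnit v)) ?_) r
  have hT : endOfUnit v (T 1) = (v : K[T;T⁻¹]) := by
    simpa using endOfUnit_C_mul_T v 1 1
  simpa [hT, ← Polynomial.C_eq_algebraMap] using h

/-- Every automorphism of `K[T;T⁻¹][X]` is affine in `X` over a monomial automorphism of
`K[T;T⁻¹]`. -/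
theorem exists_eq_affineAut_monomialAut (φ : K[T;T⁻¹][X] ≃ₐ[K] K[T;T⁻¹][X]) :
    ∃ (c u : Kˣ) (ε : ℤˣ) (m : ℤ) (p : K[T;T⁻¹]),
      φ = affineAut (monomialAut c ε) (unitMonomial u m) p := by
  obtain ⟨c, n, hφ⟩ := exists_algEquiv_C_T_eq φ
  obtain ⟨d, k, hφ'⟩ := exists_algEquiv_C_T_eq φ.symm
  have hnk : unitMonomial (c ^ k * d) (n * k) = unitMonomial (1 : Kˣ) 1 := by
    have h := congrArg φ hφ'
    rw [φ.apply_symm_apply, algEquiv_C_eq_of_C_T_eq φ _ hφ, endOfUnit_unitMonomial] at h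
    rw [← Units.val_inj, ← T_one_eq_unitMonomial, Polynomial.C_injective h]
  let ε : ℤˣ := Units.mkOfMulEqOne n k (unitMonomial_inj.1 hnk).2
  obtain ⟨a, p, h⟩ := exists_eq_affineAut φ (monomialAut c ε) (algEquiv_C_eq_of_C_T_eq φ _ hφ)
  obtain ⟨u, m, rfl⟩ := exists_unitMonomial_eq a
  exact ⟨c, u, ε, m, p, h⟩

variable (K)

/-- The translations `X ↦ X + p`. -/
noncomputable def translationHom :
    Multiplicative K[T;T⁻¹] →* (K[T;T⁻¹][X] ≃ₐ[K] K[T;T⁻¹][X]) :=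
  MonoidHom.mk' (fun p ↦ affineAut (monomialAut 1 1) (unitMonomial 1 0) p.toAdd) fun p q ↦ by
    simp [affineAut_mul]

/-- The torus action `X ↦ t₁ * X`, `T ↦ t₂ * T`. -/
noncomputable def torusHom : Kˣ × Kˣ →* (K[T;T⁻¹][X] ≃ₐ[K] K[T;T⁻¹][X]) :=
  MonoidHom.mk' (fun t ↦ affineAut (monomialAut t.2 1) (unitMonomial t.1 0) 0) fun s t ↦ by
    simp [affineAut_mul, monomialAut_mul, map_monomialAut_unitMonomial, unitMonomial_mul,
      -val_unitMonomial]

/-- The automorphisms `X ↦ T ^ n * X`. -/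
noncomputable def shearHom : Multiplicative ℤ →* (K[T;T⁻¹][X] ≃ₐ[K] K[T;T⁻¹][X]) :=
  MonoidHom.mk' (fun n ↦ affineAut (monomialAut 1 1) (unitMonomial 1 n.toAdd) 0) fun m n ↦ by
    rw [affineAut_mul, monomialAut_mul, map_monomialAut_unitMonomial, unitMonomial_mul]
    simp

/-- The isomorphism of the additive group `ℤ/2ℤ` with the unit group of `ℤ`. -/
def zmodTwoHom : Multiplicative (ZMod 2) →* ℤˣ :=
  MonoidHom.mk' (fun i ↦ if i = 1 then 1 else -1) (by decide)

/-- The automorphisms `T ↦ T ^ (-1) ^ i`. -/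
noncomputable def inversionHom :
    Multiplicative (ZMod 2) →* (K[T;T⁻¹][X] ≃ₐ[K] K[T;T⁻¹][X]) :=
  MonoidHom.mk' (fun i ↦ affineAut (monomialAut 1 (zmodTwoHom i)) (unitMonomial 1 0) 0)
    fun i j ↦ by
      rw [affineAut_mul, monomialAut_mul, map_monomialAut_unitMonomial, unitMonomial_mul]
      simp

variable {K}

theorem zmodTwoHom_injective : Function.Injective zmodTwoHom := by decide

theorem zmodTwoHom_surjective : Function.Surjective zmodTwoHom := by decide

theorem affineAut_monomialAut_mul (c d u v : Kˣ) (ε δ : ℤˣ) (m n : ℤ) (p q : K[T;T⁻¹]) :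
    affineAut (monomialAut c ε) (unitMonomial u m) p *
        affineAut (monomialAut d δ) (unitMonomial v n) q =
      affineAut (monomialAut (c ^ (δ : ℤ) * d) (ε * δ)) (unitMonomial (u * (c ^ n * v)) (m + ε * n))
        (unitMonomial (c ^ n * v) (ε * n) * p + monomialAut c ε q) := by
  rw [affineAut_mul, monomialAut_mul, map_monomialAut_unitMonomial, monomialAut_unitMonomial,
    unitMonomial_mul]

theorem affineAut_monomialAut_inj {c d u v : Kˣ} {ε δ : ℤˣ} {m n : ℤ} {p q : K[T;T⁻¹]} :
    affineAut (monomialAut c ε) (unitMonomial u m) p =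
        affineAut (monomialAut d δ) (unitMonomial v n) q ↔
      (c = d ∧ ε = δ) ∧ (u = v ∧ m = n) ∧ p = q := by
  rw [affineAut_inj, monomialAut_inj, unitMonomial_inj]

theorem translationHom_mul_torusHom (p : Multiplicative K[T;T⁻¹]) (t : Kˣ × Kˣ) :
    translationHom K p * torusHom K t =
      affineAut (monomialAut t.2 1) (unitMonomial t.1 0) (unitMonomial t.1 0 * p.toAdd) := by
  refine (affineAut_monomialAut_mul ..).trans ?_
  simp

theorem shearHom_mul_inversionHom (n : Multiplicative ℤ) (i : Multiplicative (ZMod 2)) :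
    shearHom K n * inversionHom K i =
      affineAut (monomialAut 1 (zmodTwoHom i)) (unitMonomial 1 n.toAdd) 0 := by
  refine (affineAut_monomialAut_mul ..).trans ?_
  simp

theorem exists_translationTorusHom :
    ∃ (φ : Kˣ × Kˣ →* MulAut (Multiplicative K[T;T⁻¹]))
      (F : Multiplicative K[T;T⁻¹] ⋊[φ] (Kˣ × Kˣ) →* (K[T;T⁻¹][X] ≃ₐ[K] K[T;T⁻¹][X])),
      Function.Injective F ∧ (∀ p, F (.inl p) = translationHom K p) ∧
      (∀ t, F (.inr t) = torusHom K t) ∧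
      ∀ x, F x = translationHom K x.left * torusHom K x.right := by
  refine SemidirectProduct.exists_hom_injective _ _ (fun p q h ↦ ?_) (fun t p ↦ ?_) fun p t h ↦ ?_
  · exact (affineAut_monomialAut_inj.1 h).2.2
  · refine ⟨.ofAdd ((unitMonomial t.1 0)⁻¹ * monomialAut t.2 1 p.toAdd : K[T;T⁻¹]), ?_⟩
    rw [translationHom_mul_torusHom]
    refine (affineAut_monomialAut_mul ..).trans ?_
    simp [-val_unitMonomial]
  · obtain ⟨⟨h₂, -⟩, ⟨h₁, -⟩, -⟩ := affineAut_monomialAut_inj.1 h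
    exact Prod.ext h₁.symm h₂.symm

theorem exists_shearInversionHom :
    ∃ (φ : Multiplicative (ZMod 2) →* MulAut (Multiplicative ℤ))
      (F : Multiplicative ℤ ⋊[φ] Multiplicative (ZMod 2) →* (K[T;T⁻¹][X] ≃ₐ[K] K[T;T⁻¹][X])),
      Function.Injective F ∧ (∀ n, F (.inl n) = shearHom K n) ∧
      (∀ i, F (.inr i) = inversionHom K i) ∧
      ∀ x, F x = shearHom K x.left * inversionHom K x.right := by
  refine SemidirectProduct.exists_hom_injective _ _ (fun p q h ↦ ?_) (fun i n ↦ ?_) fun n i h ↦ ?_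
  · exact (affineAut_monomialAut_inj.1 h).2.1.2
  · refine ⟨.ofAdd (zmodTwoHom i * n.toAdd), ?_⟩
    rw [shearHom_mul_inversionHom]
    refine (affineAut_monomialAut_mul ..).trans ?_
    simp [mul_comm]
  · refine zmodTwoHom_injective ?_
    rw [map_one]
    exact (affineAut_monomialAut_inj.1 h).1.2.symm

theorem affineAut_monomialAut_eq_mul (c u : Kˣ) (ε : ℤˣ) (m : ℤ) (p : K[T;T⁻¹]) :
    affineAut (monomialAut c ε) (unitMonomial u m) p =
      affineAut (monomialAut (c ^ (ε : ℤ)) 1) (unitMonomial (u * c ^ (-(ε * m))) 0)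
          ((unitMonomial (c ^ (ε * m)) m)⁻¹ * p : K[T;T⁻¹]) *
        affineAut (monomialAut 1 ε) (unitMonomial 1 m) 0 := by
  rw [affineAut_monomialAut_mul, affineAut_monomialAut_inj]
  refine ⟨⟨?_, by simp⟩, ⟨?_, by simp⟩, ?_⟩
  · rw [← zpow_mul, ← Units.val_mul, Int.units_mul_self, Units.val_one, zpow_one, mul_one]
  · rw [← zpow_mul, zpow_neg, mul_one, inv_mul_cancel_right]
  · rw [← zpow_mul, mul_one, Units.val_one, one_mul, map_zero, add_zero, Units.mul_inv_cancel_left]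

theorem exists_semidirectProduct_mulEquiv :
    ∃ (φ₁ : Kˣ × Kˣ →* MulAut (Multiplicative K[T;T⁻¹]))
      (φ₃ : Multiplicative (ZMod 2) →* MulAut (Multiplicative ℤ))
      (φ₂ : Multiplicative ℤ ⋊[φ₃] Multiplicative (ZMod 2) →*
        MulAut (Multiplicative K[T;T⁻¹] ⋊[φ₁] (Kˣ × Kˣ)))
      (e : (Multiplicative K[T;T⁻¹] ⋊[φ₁] (Kˣ × Kˣ)) ⋊[φ₂]
          (Multiplicative ℤ ⋊[φ₃] Multiplicative (ZMod 2)) ≃*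
        (K[T;T⁻¹][X] ≃ₐ[K] K[T;T⁻¹][X])),
      (∀ p, e (.inl (.inl p)) = translationHom K p) ∧ (∀ t, e (.inl (.inr t)) = torusHom K t) ∧
      (∀ n, e (.inr (.inl n)) = shearHom K n) ∧ ∀ i, e (.inr (.inr i)) = inversionHom K i := by
  obtain ⟨φ₁, F₁, hF₁inj, hF₁p, hF₁t, hF₁⟩ := exists_translationTorusHom (K := K)
  obtain ⟨φ₃, F₃, hF₃inj, hF₃n, hF₃i, hF₃⟩ := exists_shearInversionHom (K := K)
  simp only [translationHom_mul_torusHom] at hF₁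
  simp only [shearHom_mul_inversionHom] at hF₃
  have hF₁surj (c u : Kˣ) (q : K[T;T⁻¹]) :
      ∃ x, F₁ x = affineAut (monomialAut c 1) (unitMonomial u 0) q :=
    ⟨⟨.ofAdd ((unitMonomial u 0)⁻¹ * q : K[T;T⁻¹]), (u, c)⟩, by
      rw [hF₁, toAdd_ofAdd, Units.mul_inv_cancel_left]⟩
  obtain ⟨φ₂, F₂, hF₂inj, hF₂₁, hF₂₃, hF₂⟩ := SemidirectProduct.exists_hom_injective F₁ F₃ hF₁inj
    (fun h x ↦ by
      obtain ⟨y, hy⟩ := hF₁surj _ _ _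
      refine ⟨y, ?_⟩
      rw [hF₁ x, hF₃, affineAut_monomialAut_mul, affineAut_monomialAut_eq_mul, hy]
      simp only [mul_one, mul_zero, add_zero]
      rfl)
    (fun x h hxh ↦ hF₃inj <| by
      rw [hF₁, hF₃, affineAut_monomialAut_inj] at hxh
      rw [hF₃, ← hxh.1.2, ← hxh.2.1.2]
      simp)
  refine ⟨φ₁, φ₃, φ₂, MulEquiv.ofBijective F₂ ⟨hF₂inj, fun ψ ↦ ?_⟩, fun p ↦ ?_, fun t ↦ ?_,
    fun n ↦ ?_, fun i ↦ ?_⟩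
  · obtain ⟨c, u, ε, m, p, rfl⟩ := exists_eq_affineAut_monomialAut ψ
    obtain ⟨i, rfl⟩ := zmodTwoHom_surjective ε
    rw [affineAut_monomialAut_eq_mul]
    obtain ⟨y, hy⟩ := hF₁surj _ _ _
    refine ⟨⟨y, .ofAdd m, i⟩, ?_⟩
    rw [hF₂, hF₃, hy]
    rfl
  · exact (hF₂₁ _).trans (hF₁p p)
  · exact (hF₂₁ _).trans (hF₁t t)
  · exact (hF₂₃ _).trans (hF₃n n)
  · exact (hF₂₃ _).trans (hF₃i i)

end LaurentPolynomial

/-- **Automorphisms of `K[x, y^{±1}]`.**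
Realizing `K[x, y^{±1}]` as `Polynomial (LaurentPolynomial K)` (with `x = X` and
`y = C (T 1)`): every `K`-algebra automorphism sends `y ↦ c·y^ε`, `x ↦ u·y^m·x + p(y)`
with `c, u ∈ Kˣ`, `ε ∈ {1,-1}`, `m ∈ ℤ`, `p ∈ K[y, y⁻¹]`, and conversely; and the
automorphism group is isomorphic to `(U ⋊ T) ⋊ (ℤ ⋊ ℤ/2ℤ)`, where `U` is the additive
group of `K[y, y⁻¹]` acting by translations `x ↦ x + p(y)`, `T ≅ (Kˣ)²` acts by
`x ↦ t₁·x`, `y ↦ t₂·y`, the factor `ℤ` is generated by `x ↦ x·y, y ↦ y`, and `ℤ/2ℤ` by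
`x ↦ x, y ↦ y⁻¹`. -/
theorem aut_of_A1_times_A1_star
    {K : Type*} [Field K] [IsAlgClosed K] [CharZero K] :
    (∀ φ : Polynomial (LaurentPolynomial K) ≃ₐ[K] Polynomial (LaurentPolynomial K),
      ∃ (c u : Kˣ) (ε m : ℤ) (p : LaurentPolynomial K), (ε = 1 ∨ ε = -1) ∧
        φ (Polynomial.C (T 1)) = Polynomial.C (LaurentPolynomial.C (c : K) * T ε) ∧
        φ Polynomial.X =
          Polynomial.C (LaurentPolynomial.C (u : K) * T m) * Polynomial.X + Polynomial.C p) ∧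
    (∀ (c u : Kˣ) (ε m : ℤ) (p : LaurentPolynomial K), (ε = 1 ∨ ε = -1) →
      ∃ φ : Polynomial (LaurentPolynomial K) ≃ₐ[K] Polynomial (LaurentPolynomial K),
        φ (Polynomial.C (T 1)) = Polynomial.C (LaurentPolynomial.C (c : K) * T ε) ∧
        φ Polynomial.X =
          Polynomial.C (LaurentPolynomial.C (u : K) * T m) * Polynomial.X + Polynomial.C p) ∧
    ∃ (φ₁ : (Kˣ × Kˣ) →* MulAut (Multiplicative (LaurentPolynomial K)))
      (φ₃ : Multiplicative (ZMod 2) →* MulAut (Multiplicative ℤ))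
      (φ₂ : (Multiplicative ℤ ⋊[φ₃] Multiplicative (ZMod 2)) →*
        MulAut (Multiplicative (LaurentPolynomial K) ⋊[φ₁] (Kˣ × Kˣ)))
      (e : ((Multiplicative (LaurentPolynomial K) ⋊[φ₁] (Kˣ × Kˣ)) ⋊[φ₂]
              (Multiplicative ℤ ⋊[φ₃] Multiplicative (ZMod 2))) ≃*
            (Polynomial (LaurentPolynomial K) ≃ₐ[K] Polynomial (LaurentPolynomial K))),
      (∀ p : LaurentPolynomial K,
        e (SemidirectProduct.inl (SemidirectProduct.inl (Multiplicative.ofAdd p)))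
            Polynomial.X = Polynomial.X + Polynomial.C p ∧
        e (SemidirectProduct.inl (SemidirectProduct.inl (Multiplicative.ofAdd p)))
            (Polynomial.C (T 1)) = Polynomial.C (T 1)) ∧
      (∀ t : Kˣ × Kˣ,
        e (SemidirectProduct.inl (SemidirectProduct.inr t)) Polynomial.X =
          Polynomial.C (LaurentPolynomial.C (t.1 : K)) * Polynomial.X ∧
        e (SemidirectProduct.inl (SemidirectProduct.inr t)) (Polynomial.C (T 1)) =
          Polynomial.C (LaurentPolynomial.C (t.2 : K) * T 1)) ∧
      (e (SemidirectProduct.inr (SemidirectProduct.inl (Multiplicative.ofAdd (1 : ℤ))))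
          Polynomial.X = Polynomial.C (T 1) * Polynomial.X ∧
       e (SemidirectProduct.inr (SemidirectProduct.inl (Multiplicative.ofAdd (1 : ℤ))))
          (Polynomial.C (T 1)) = Polynomial.C (T 1)) ∧
      (e (SemidirectProduct.inr (SemidirectProduct.inr (Multiplicative.ofAdd (1 : ZMod 2))))
          Polynomial.X = Polynomial.X ∧
       e (SemidirectProduct.inr (SemidirectProduct.inr (Multiplicative.ofAdd (1 : ZMod 2))))
          (Polynomial.C (T 1)) = Polynomial.C (T (-1))) := by
  refine ⟨fun φ ↦ ?_, fun c u ε m p hε ↦ ?_, ?_⟩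
  · obtain ⟨c, u, ε, m, p, rfl⟩ := exists_eq_affineAut_monomialAut φ
    refine ⟨c, u, ε, m, p, ?_, ?_, ?_⟩
    · exact Int.isUnit_iff.1 ε.isUnit
    · rw [affineAut_C, monomialAut_T_one, val_unitMonomial]
    · rw [affineAut_X, val_unitMonomial]
  · obtain ⟨ε, rfl⟩ := Int.isUnit_iff.2 hε
    refine ⟨affineAut (monomialAut c ε) (unitMonomial u m) p, ?_, ?_⟩
    · rw [affineAut_C, monomialAut_T_one, val_unitMonomial]
    · rw [affineAut_X, val_unitMonomial]
  · obtain ⟨φ₁, φ₃, φ₂, e, hp, ht, hn, hi⟩ := exists_semidirectProduct_mulEquiv (K := K)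
    refine ⟨φ₁, φ₃, φ₂, e, fun p ↦ ?_, fun t ↦ ?_, ?_, ?_⟩
    · simp [hp, translationHom]
    · simp [ht, torusHom, monomialAut_T_one]
    · simp [hn, shearHom]
    · simp [hi, inversionHom, monomialAut_T_one, zmodTwoHom]
end

section
/- Let A be a commutative group and N ∈ ℕ. Every subgroup H of the direct product A × ℤ^N is isomorphic to Υ × ℤ^l for some integer 0 ≤ l ≤ N, where Υ is the subgroup H ∩ (A × {0}) of A (so Υ is isomorphic to a subgroup of A). -/
/-- A split short exact sequence `U → G → F` of groups, with `G` commutative, exhibits `G` as the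
product of `U` and `F`. -/
theorem MonoidHom.bijective_coprod_of_comp_eq_id {U G F : Type*} [Group U] [CommGroup G] [Group F]
    (i : U →* G) (p : G →* F) (s : F →* G) (hi : Function.Injective i)
    (hps : p.comp s = MonoidHom.id F) (hip : i.range = p.ker) :
    Function.Bijective (i.coprod s) := by
  have hs (x : F) : p (s x) = x := DFunLike.congr_fun hps x
  have hpi (u : U) : p (i u) = 1 := by
    rw [← MonoidHom.mem_ker, ← hip]
    exact ⟨u, rfl⟩
  constructor
  · rw [injective_iff_map_eq_one]
    rintro ⟨u, x⟩ h
    rw [MonoidHom.coprod_apply] at h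
    have hx : x = 1 := by simpa [hpi, hs] using congrArg p h
    subst hx
    have hu : u = 1 := hi (by simpa using h)
    rw [hu, Prod.mk_one_one]
  · intro g
    have hg : g * (s (p g))⁻¹ ∈ i.range := by
      rw [hip, MonoidHom.mem_ker, map_mul, map_inv, hs, mul_inv_cancel]
    obtain ⟨u, hu⟩ := hg
    exact ⟨(u, p g), by simp [hu]⟩

/-- A linear map into `R^N`, with `R` a principal ideal domain, has the same kernel as a split
surjection onto `R^l` for some `l ≤ N`. -/
theorem LinearMap.exists_split_surjection_ker_eq {R M : Type*} [CommRing R] [IsDomain R]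
    [IsPrincipalIdealRing R] [AddCommGroup M] [Module R M] {N : ℕ} (f : M →ₗ[R] (Fin N → R)) :
    ∃ l ≤ N, ∃ (p : M →ₗ[R] (Fin l → R)) (s : (Fin l → R) →ₗ[R] M),
      p ∘ₗ s = LinearMap.id ∧ LinearMap.ker p = LinearMap.ker f := by
  let e := (Module.finBasis R (LinearMap.range f)).equivFun
  obtain ⟨s, hs⟩ := Module.projective_lifting_property (e.toLinearMap ∘ₗ f.rangeRestrict)
    LinearMap.id (e.surjective.comp f.surjective_rangeRestrict)
  refine ⟨_, ?_, _, s, hs, ?_⟩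
  · simpa using Submodule.finrank_le (LinearMap.range f)
  · rw [LinearEquiv.ker_comp, LinearMap.ker_rangeRestrict]

/-- A homomorphism from a commutative group into `ℤ^N` has the same kernel as a split surjection
onto `ℤ^l` for some `l ≤ N`. -/
theorem MonoidHom.exists_split_surjection_ker_eq {G : Type*} [CommGroup G] {N : ℕ}
    (f : G →* Multiplicative (Fin N → ℤ)) :
    ∃ l ≤ N, ∃ (p : G →* Multiplicative (Fin l → ℤ)) (s : Multiplicative (Fin l → ℤ) →* G),
      p.comp s = MonoidHom.id _ ∧ p.ker = f.ker := by
  obtain ⟨l, hl, p, s, hps, hker⟩ :=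
    LinearMap.exists_split_surjection_ker_eq (MonoidHom.toAdditiveLeft f).toIntLinearMap
  refine ⟨l, hl, AddMonoidHom.toMultiplicativeRight p.toAddMonoidHom,
    AddMonoidHom.toMultiplicativeLeft s.toAddMonoidHom, ?_, ?_⟩
  · refine MonoidHom.ext fun x => ?_
    exact LinearMap.congr_fun hps x.toAdd
  · ext g
    exact SetLike.ext_iff.mp hker (Additive.ofMul g)


/-- Every subgroup `H` of a direct product `A × ℤ^N`, with `A` a commutative group,
is isomorphic to `Υ × ℤ^l` for some `0 ≤ l ≤ N`, where `Υ = H ∩ (A × {0})`,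
viewed as a subgroup of `A` via the first projection. -/
theorem subgroup_of_prod_commGroup_free_abelian
    {A : Type*} [CommGroup A] (N : ℕ)
    (H : Subgroup (A × Multiplicative (Fin N → ℤ))) :
    ∃ l : ℕ, l ≤ N ∧
      Nonempty (H ≃* (H.comap (MonoidHom.inl A (Multiplicative (Fin N → ℤ)))) ×
        Multiplicative (Fin l → ℤ)) := by
  obtain ⟨l, hl, p, s, hps, hker⟩ := MonoidHom.exists_split_surjection_ker_eq
    ((MonoidHom.snd A (Multiplicative (Fin N → ℤ))).comp H.subtype)
  refine ⟨l, hl, ⟨(MulEquiv.ofBijective _ (MonoidHom.bijective_coprod_of_comp_eq_id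
    ((MonoidHom.inl A (Multiplicative (Fin N → ℤ))).subgroupComap H) p s ?_ hps ?_)).symm⟩⟩
  · intro u v huv
    exact Subtype.ext (congrArg (fun h : H => h.1.1) huv)
  · rw [hker]
    ext ⟨⟨a, x⟩, h⟩
    constructor
    · rintro ⟨u, hu⟩
      exact (congrArg (fun h : H => h.1.2) hu).symm
    · intro hx
      obtain rfl : x = 1 := hx
      exact ⟨⟨a, h⟩, rfl⟩
end

section
/- Let G = A *_C B be the amalgamated free product of groups A and B along injective homomorphisms φ_A : C → A and φ_B : C → B, and let N be a normal subgroup of G contained in the image of C in G; let K ≤ C be the preimage of N in C (so K maps isomorphically onto N). Then φ_A(K) is a normal subgroup of A, φ_B(K) is a normal subgroup of B, K is normal in C, the induced homomorphisms C/K → A/φ_A(K) and C/K → B/φ_B(K) are injective, and the quotient G/N is canonically isomorphic to the amalgamated free product (A/φ_A(K)) *_{C/K} (B/φ_B(K)). -/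
open Monoid PushoutI

/-- The preimage in a factor of a subgroup lying in the base of an amalgam is the image of its
preimage in the base. -/
theorem Monoid.PushoutI.comap_of_eq_map_comap_base {ι C : Type*} [Group C] {𝔊 : ι → Type*}
    [∀ i, Group (𝔊 i)] {φ : ∀ i, C →* 𝔊 i} (hφ : ∀ i, Function.Injective (φ i))
    {N : Subgroup (PushoutI φ)} (hN : N ≤ (base φ).range) (i : ι) :
    N.comap (of i) = (N.comap (base φ)).map (φ i) := by
  ext g
  simp only [Subgroup.mem_comap, Subgroup.mem_map]
  constructor
  · intro hg
    obtain ⟨c, hc⟩ := hN hg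
    refine ⟨c, hc ▸ hg, of_injective hφ i ?_⟩
    rw [of_apply_eq_base, hc]
  · rintro ⟨c, hc, rfl⟩
    rwa [of_apply_eq_base]

/-- **Quotient of an amalgam by a normal subgroup of the amalgamated part.**
Let `G = A *_C B` be the amalgamated free product of `A = 𝔊 true` and `B = 𝔊 false` along
injective homomorphisms `φ i : C →* 𝔊 i` (`i : Bool`), realized as `Monoid.PushoutI φ`, and
let `N` be a normal subgroup of `G` contained in the image of `C`; let `K ≤ C` be the
preimage of `N`. Then `K` is normal in `C`, each `φ i (K)` is normal in `𝔊 i`, the induced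
homomorphisms `C/K → 𝔊 i / φ i (K)` are injective, and `G/N` is canonically isomorphic to
the amalgamated free product of the quotients. -/
theorem quotient_of_amalgam_by_normal_subgroup_of_base
    {C : Type*} [Group C] {𝔊 : Bool → Type*} [∀ i, Group (𝔊 i)]
    (φ : ∀ i, C →* 𝔊 i) (hφ : ∀ i, Function.Injective (φ i))
    (N : Subgroup (Monoid.PushoutI φ)) [N.Normal]
    (hN : N ≤ (Monoid.PushoutI.base (φ := φ)).range)
    (K : Subgroup C) (hK : K = N.comap (Monoid.PushoutI.base (φ := φ))) :
    K.Normal ∧ (∀ i, (K.map (φ i)).Normal) ∧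
    ∀ [hKn : K.Normal] [hKm : ∀ i, (K.map (φ i)).Normal],
      (∀ i, Function.Injective
        (QuotientGroup.map K (K.map (φ i)) (φ i) (Subgroup.le_comap_map (φ i) K))) ∧
      ∃ e : Monoid.PushoutI
            (fun i => QuotientGroup.map K (K.map (φ i)) (φ i)
              (Subgroup.le_comap_map (φ i) K)) ≃*
          (Monoid.PushoutI φ ⧸ N),
        ∀ (i : Bool) (g : 𝔊 i),
          e (Monoid.PushoutI.of
              (φ := fun i => QuotientGroup.map K (K.map (φ i)) (φ i)
                (Subgroup.le_comap_map (φ i) K)) i (QuotientGroup.mk g)) =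
            QuotientGroup.mk (Monoid.PushoutI.of (φ := φ) i g) := by
  have hmap (i : Bool) : N.comap (of i) = K.map (φ i) :=
    hK ▸ comap_of_eq_map_comap_base hφ hN i
  refine ⟨hK ▸ inferInstance, fun i => hmap i ▸ inferInstance, ?_⟩
  intro hKn hKm
  refine ⟨fun i => ?_, ?_⟩
  · rw [← MonoidHom.ker_eq_bot_iff, QuotientGroup.ker_map,
      Subgroup.comap_map_eq_self_of_injective (hφ i), QuotientGroup.map_mk'_self]
  · let ψ (i : Bool) : C ⧸ K →* 𝔊 i ⧸ K.map (φ i) :=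
      QuotientGroup.map K (K.map (φ i)) (φ i) (Subgroup.le_comap_map (φ i) K)
    let toQuot : PushoutI ψ →* PushoutI φ ⧸ N :=
      lift (fun i => QuotientGroup.map (K.map (φ i)) N (of i) (hmap i).ge)
        (QuotientGroup.map K N (base φ) hK.le) fun i => by
          ext c
          simp [ψ, of_apply_eq_base]
    let toPushout : PushoutI φ →* PushoutI ψ :=
      lift (fun i => (of i).comp (QuotientGroup.mk' (K.map (φ i))))
        ((base ψ).comp (QuotientGroup.mk' K)) fun i => by
          ext c
          exact of_apply_eq_base ψ i (QuotientGroup.mk c)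
    have hker : N ≤ toPushout.ker := by
      intro n hn
      obtain ⟨c, rfl⟩ := hN hn
      have hc : c ∈ K := hK ▸ hn
      simp [toPushout, MonoidHom.mem_ker, (QuotientGroup.eq_one_iff c).2 hc]
    refine ⟨toQuot.toMulEquiv (QuotientGroup.lift N toPushout hker) ?_ ?_, fun i g => ?_⟩
    · ext i g
      simp [toQuot, toPushout]
    · ext i g
      simp [toQuot, toPushout]
    · simp [toQuot, ψ]
end

section
/- Let G = A *_C B be the amalgamated free product of groups A and B along injective homomorphisms φ_A : C → A and φ_B : C → B, with A and B identified with their images in G. Define a simple graph 𝒯 whose vertex set is the disjoint union of the sets of left cosets G/A and G/B, in which a coset gA is adjacent to a coset hB if and only if gA ∩ hB ≠ ∅ (and no two cosets of A, nor two cosets of B, are adjacent). Then 𝒯 is a tree, i.e., it is connected and contains no cycles. -/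
namespace Monoid.PushoutI

/-- A nonempty reduced word whose last letter does not lie in the factor `G i` does not represent
an element of that factor. -/
theorem Reduced.prod_notMem_range_of {ι : Type*} {G : ι → Type*} {C : Type*} [Group C]
    [∀ i, Group (G i)] {φ : ∀ i, C →* G i} (hφ : ∀ i, Function.Injective (φ i))
    {w : CoprodI.Word G} (hw : Reduced φ w) (hne : w.toList ≠ []) {i : ι}
    (hi : (w.toList.getLast hne).1 ≠ i) :
    ofCoprodI w.prod ∉ (of (φ := φ) i).range := by
  rintro ⟨h, hh⟩
  by_cases hc : h ∈ (φ i).range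
  · obtain ⟨c, rfl⟩ := hc
    refine hne (congrArg CoprodI.Word.toList (hw.eq_empty_of_mem_range hφ ⟨c, ?_⟩))
    rw [← hh, of_apply_eq_base]
  · have hc' : h⁻¹ ∉ (φ i).range := by rwa [inv_mem_iff]
    let w' : CoprodI.Word G :=
      { toList := w.toList ++ [⟨i, h⁻¹⟩]
        ne_one := by
          intro l hl
          rcases List.mem_append.1 hl with hl | hl
          · exact w.ne_one l hl
          · rw [List.mem_singleton.1 hl]
            exact fun h1 : h⁻¹ = 1 => hc' (h1 ▸ one_mem _)
        chain_ne := by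
          rw [List.isChain_append]
          refine ⟨w.chain_ne, List.isChain_singleton _, ?_⟩
          rintro s hs t ht
          rw [List.getLast?_eq_some_getLast hne] at hs
          simp only [List.head?_cons, Option.mem_def, Option.some.injEq] at hs ht
          rw [← hs, ← ht]
          exact hi }
    have hw' : Reduced φ w' := by
      intro l hl
      rcases List.mem_append.1 hl with hl | hl
      · exact hw l hl
      · rw [List.mem_singleton.1 hl]
        exact hc'
    have hprod : ofCoprodI (φ := φ) w'.prod = 1 := by
      have : w'.prod = w.prod * CoprodI.of h⁻¹ := by
        simp [CoprodI.Word.prod, w']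
      rw [this, map_mul, ← hh, ofCoprodI_of, ← map_mul, mul_inv_cancel, map_one]
    have := congrArg CoprodI.Word.toList
      (hw'.eq_empty_of_mem_range hφ (hprod ▸ one_mem _))
    simp [w', CoprodI.Word.empty] at this

end Monoid.PushoutI

namespace BassSerre

open Monoid Monoid.PushoutI

variable {C : Type*} [Group C] {G : Bool → Type*} [∀ i, Group (G i)] {φ : ∀ i, C →* G i}

variable (φ) in
/-- The vertices of the Bass–Serre graph. -/
abbrev Vertex : Type _ :=
  (PushoutI φ ⧸ (of (φ := φ) true).range) ⊕ (PushoutI φ ⧸ (of (φ := φ) false).range)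

/-- The left coset of the factor `G i` containing `x`, as a vertex of the Bass–Serre graph. -/
def coset : Bool → PushoutI φ → Vertex φ
  | true, x => Sum.inl (QuotientGroup.mk x)
  | false, x => Sum.inr (QuotientGroup.mk x)

theorem coset_eq_iff {i j : Bool} {x y : PushoutI φ} :
    coset i x = coset j y ↔ i = j ∧ x⁻¹ * y ∈ (of (φ := φ) i).range := by
  cases i <;> cases j <;> simp [coset, QuotientGroup.eq]

theorem coset_mul_of (i : Bool) (x : PushoutI φ) (g : G i) :
    coset i (x * of i g) = coset i x :=
  (coset_eq_iff.2 ⟨rfl, g, by simp⟩).symm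

theorem exists_eq_coset (v : Vertex φ) : ∃ i x, v = coset i x := by
  rcases v with v | v <;> induction v using QuotientGroup.induction_on with | H x => ?_
  exacts [⟨true, x, rfl⟩, ⟨false, x, rfl⟩]

/-- The adjacency relation of the Bass–Serre graph: `gA` and `hB` are adjacent when they meet. -/
def IsBassSerreGraph (T : SimpleGraph (Vertex φ)) : Prop :=
  ∀ v w, T.Adj v w ↔ ∃ i x, v = coset i x ∧ w = coset (!i) x

variable {T : SimpleGraph (Vertex φ)}

theorem IsBassSerreGraph.adj_coset_not (hT : IsBassSerreGraph T) (i : Bool) (x : PushoutI φ) :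
    T.Adj (coset i x) (coset (!i) x) :=
  (hT _ _).2 ⟨i, x, rfl, rfl⟩

theorem IsBassSerreGraph.exists_of_adj_coset (hT : IsBassSerreGraph T) {i : Bool}
    {x : PushoutI φ} {v : Vertex φ} (h : T.Adj (coset i x) v) :
    ∃ g : G i, v = coset (!i) (x * of i g) := by
  obtain ⟨j, y, hv, rfl⟩ := (hT _ _).1 h
  obtain ⟨rfl, g, hg⟩ := coset_eq_iff.1 hv
  exact ⟨g, by simp [hg]⟩

theorem IsBassSerreGraph.reachable_coset_mul (hT : IsBassSerreGraph T) (x y : PushoutI φ) :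
    T.Reachable (coset true y) (coset true (y * x)) := by
  induction x using PushoutI.induction_on generalizing y with
  | of i g =>
    cases i with
    | true => rw [coset_mul_of]
    | false =>
      have h := (hT.adj_coset_not true (y * of false g)).symm.reachable
      rw [Bool.not_true, coset_mul_of] at h
      exact (hT.adj_coset_not true y).reachable.trans h
  | base c => rw [← of_apply_eq_base φ true, coset_mul_of]
  | mul a b iha ihb => simpa [mul_assoc] using (iha y).trans (ihb (y * a))

theorem IsBassSerreGraph.connected (hT : IsBassSerreGraph T) : T.Connected := by
  have key (v : Vertex φ) : T.Reachable (coset true 1) v := by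
    obtain ⟨i, x, rfl⟩ := exists_eq_coset v
    have h := hT.reachable_coset_mul x 1
    rw [one_mul] at h
    cases i with
    | true => exact h
    | false => exact h.trans (hT.adj_coset_not true x).reachable
  exact (SimpleGraph.connected_iff _).2 ⟨fun u v => (key u).symm.trans (key v), ⟨coset true 1⟩⟩

/-- A walk without backtracking spells an alternating word in which only the first letter may come
from the amalgamated subgroup. -/
theorem IsBassSerreGraph.exists_word_of_walk (hT : IsBassSerreGraph T) {u v : Vertex φ}
    (p : T.Walk u v) (hp : p.edges.IsChain (· ≠ ·)) (hnil : ¬ p.Nil) {i : Bool}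
    {x : PushoutI φ} (hu : u = coset i x) :
    ∃ (g : G i) (l : List (Σ i, G i)),
      (⟨i, g⟩ :: l).IsChain (fun s t : Σ i, G i => s.1 ≠ t.1) ∧
      (∀ s ∈ l, s.2 ∉ (φ s.1).range) ∧ l.length + 1 = p.length ∧
      p.snd = coset (!i) (x * of i g) ∧
      v = coset (!((⟨i, g⟩ :: l : List (Σ i, G i)).getLast (List.cons_ne_nil _ _)).1)
        (x * of i g * (l.map fun s => of (φ := φ) s.1 s.2).prod) := by
  induction p generalizing i x with
  | nil => simp at hnil
  | @cons u u' v h p ih =>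
    subst hu
    obtain ⟨g, rfl⟩ := hT.exists_of_adj_coset h
    by_cases hn : p.Nil
    · cases hn
      exact ⟨g, [], by simp⟩
    · rw [SimpleGraph.Walk.edges_cons, List.isChain_cons] at hp
      obtain ⟨g', l, hchain, hred, hlen, hsnd, hv⟩ := ih hp.2 hn rfl
      refine ⟨g, ⟨!i, g'⟩ :: l, ?_, ?_, by simp [hlen], by simp, ?_⟩
      · rw [List.isChain_cons_cons]
        exact ⟨by simp, hchain⟩
      · rintro s (_ | ⟨_, hs⟩)
        · rintro ⟨c, hc⟩
          replace hc : φ (!i) c = g' := hc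
          subst hc
          have hback : p.snd = coset i x := by
            rw [hsnd, of_apply_eq_base, ← of_apply_eq_base φ i, Bool.not_not, coset_mul_of,
              coset_mul_of]
          refine hp.1 s(coset (!i) (x * of i g), p.snd) ?_ (by rw [hback, Sym2.eq_swap])
          cases p with
          | nil => simp at hn
          | cons => simp
        · exact hred s hs
      · simpa [mul_assoc] using hv

theorem IsBassSerreGraph.isAcyclic (hT : IsBassSerreGraph T)
    (hφ : ∀ i, Function.Injective (φ i)) : T.IsAcyclic := by
  intro u c hc
  obtain ⟨i, x, hu⟩ := exists_eq_coset u
  obtain ⟨g, l, hchain, hred, hlen, -, hend⟩ :=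
    hT.exists_word_of_walk c hc.edges_nodup.isChain hc.not_nil hu
  have hne : l ≠ [] := by
    rintro rfl
    have := hc.three_le_length
    simp at hlen
    omega
  obtain ⟨hi, hmem⟩ := coset_eq_iff.1 (hu.symm.trans hend)
  let w : CoprodI.Word G :=
    { toList := l
      ne_one := fun s hs h1 => hred s hs (h1 ▸ one_mem _)
      chain_ne := hchain.tail }
  have hw : Reduced φ w := hred
  refine hw.prod_notMem_range_of hφ (i := i) hne ?_ ?_
  · rw [List.getLast_cons hne] at hi
    rw [hi]
    exact (Bool.not_ne_self _).symm
  · have hprod : ofCoprodI (φ := φ) w.prod = (l.map fun s => of (φ := φ) s.1 s.2).prod := by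
      simp [CoprodI.Word.prod, w, map_list_prod, Function.comp_def]
    rw [hprod]
    rwa [mul_assoc, inv_mul_cancel_left,
      Subgroup.mul_mem_cancel_left _ (MonoidHom.mem_range.2 ⟨g, rfl⟩)] at hmem

end BassSerre

/-- **The Bass–Serre graph of an amalgam `A *_C B` is a tree.**
Here the amalgamated free product of `A = G true` and `B = G false` along the injective
homomorphisms `φ i : C →* G i` (`i : Bool`) is `Monoid.PushoutI φ`, the factors being
identified with their images. The graph has as vertices the disjoint union of the left
coset spaces of the two factors, a coset `gA` being adjacent to a coset `hB` exactly when
`gA ∩ hB ≠ ∅` (and no two cosets of the same factor being adjacent). -/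
theorem bass_serre_graph_isTree
    {C : Type*} [Group C] {G : Bool → Type*} [∀ i, Group (G i)]
    (φ : ∀ i, C →* G i) (hφ : ∀ i, Function.Injective (φ i))
    (T : SimpleGraph
      ((Monoid.PushoutI φ ⧸ (Monoid.PushoutI.of (φ := φ) true).range) ⊕
       (Monoid.PushoutI φ ⧸ (Monoid.PushoutI.of (φ := φ) false).range)))
    (hT : ∀ v w, T.Adj v w ↔
      ∃ (a : Monoid.PushoutI φ ⧸ (Monoid.PushoutI.of (φ := φ) true).range)
        (b : Monoid.PushoutI φ ⧸ (Monoid.PushoutI.of (φ := φ) false).range),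
        ((v = Sum.inl a ∧ w = Sum.inr b) ∨ (v = Sum.inr b ∧ w = Sum.inl a)) ∧
        ∃ x : Monoid.PushoutI φ,
          (QuotientGroup.mk x : Monoid.PushoutI φ ⧸
              (Monoid.PushoutI.of (φ := φ) true).range) = a ∧
          (QuotientGroup.mk x : Monoid.PushoutI φ ⧸
              (Monoid.PushoutI.of (φ := φ) false).range) = b) :
    T.IsTree := by
  have hT' : BassSerre.IsBassSerreGraph T := by
    intro v w
    rw [hT]
    constructor
    · rintro ⟨_, _, ⟨rfl, rfl⟩ | ⟨rfl, rfl⟩, x, rfl, rfl⟩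
      exacts [⟨true, x, rfl, rfl⟩, ⟨false, x, rfl, rfl⟩]
    · rintro ⟨_ | _, x, rfl, rfl⟩
      exacts [⟨_, _, .inr ⟨rfl, rfl⟩, x, rfl, rfl⟩, ⟨_, _, .inl ⟨rfl, rfl⟩, x, rfl, rfl⟩]
  exact ⟨hT'.connected, hT'.isAcyclic hφ⟩
end

section
/- Let T be a tree (a connected acyclic simple graph), and let a group H act on T by graph automorphisms without inversions, i.e., no element of H interchanges the two endpoints of any edge of T. If some vertex v has an H-orbit of finite diameter with respect to the graph distance (there exists D ∈ ℕ such that dist(h·v, h′·v) ≤ D for all h, h′ ∈ H), then H fixes a vertex of T: there exists a vertex w with h·w = w for all h ∈ H. -/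
namespace SimpleGraph

variable {V : Type*} {T : SimpleGraph V}

/-- In a tree, a vertex has at most one neighbour closer to a given vertex. -/
theorem IsTree.eq_of_adj_of_dist_add_one_eq (hT : T.IsTree) {x a b m : V}
    (ha : T.Adj a m) (hb : T.Adj b m)
    (hda : T.dist x a + 1 = T.dist x m) (hdb : T.dist x b + 1 = T.dist x m) : a = b := by
  obtain ⟨p, hp⟩ := hT.connected.exists_walk_length_eq_dist x a
  obtain ⟨q, hq⟩ := hT.connected.exists_walk_length_eq_dist x b
  have hpm : (p.concat ha).IsPath :=
    Walk.isPath_of_length_eq_dist _ (by rw [Walk.length_concat]; omega)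
  have hqm : (q.concat hb).IsPath :=
    Walk.isPath_of_length_eq_dist _ (by rw [Walk.length_concat]; omega)
  have h := congrArg Walk.penultimate ((hT.existsUnique_path x m).unique hpm hqm)
  simpa using h

/-- Once the distance to `x` increases along a path in a tree, it keeps increasing. -/
theorem IsTree.dist_eq_dist_add_length (hT : T.IsTree) {x u m w : V} (hum : T.Adj u m)
    (p : T.Walk m w) (hp : (p.cons hum).IsPath) (hd : T.dist x u + 1 = T.dist x m) :
    T.dist x w = T.dist x m + p.length := by
  induction p generalizing u with
  | nil => simp
  | @cons m k w hmk p ih =>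
    have hk : T.dist x m + 1 = T.dist x k := by
      rcases hT.dist_eq_dist_add_one_of_adj x hmk with h | h
      · have huk := hT.eq_of_adj_of_dist_add_one_eq hum hmk.symm hd h.symm
        simp [Walk.cons_isPath_iff, huk] at hp
      · exact h.symm
    rw [ih hmk hp.of_cons hk, Walk.length_cons]
    omega

/-- Two vertices of a tree at distance at least two have a vertex between them that is
strictly closer to every vertex than the farther of the two. -/
theorem IsTree.exists_forall_dist_lt_max (hT : T.IsTree) {u w : V} (huw : 2 ≤ T.dist u w) :
    ∃ m, ∀ x, T.dist x m < max (T.dist x u) (T.dist x w) := by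
  obtain ⟨p, hp, hl⟩ := hT.connected.exists_path_of_dist u w
  cases p with
  | nil => simp at huw
  | @cons _ m _ hum p =>
    refine ⟨m, fun x => ?_⟩
    rw [Walk.length_cons] at hl
    rcases hT.dist_eq_dist_add_one_of_adj x hum with h | h
    · exact lt_max_of_lt_left (by omega)
    · have := hT.dist_eq_dist_add_length hum p hp h.symm
      exact lt_max_of_lt_right (by omega)

/-- A tree contains no triangle. -/
theorem IsTree.not_adj_of_adj_of_adj (hT : T.IsTree) {a b c : V}
    (hab : T.Adj a b) (hbc : T.Adj b c) : ¬ T.Adj a c := fun hac =>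
  hT.dist_ne_of_adj a hbc (by rw [dist_eq_one_iff_adj.2 hab, dist_eq_one_iff_adj.2 hac])

/-- Graph homomorphisms do not increase distances. -/
theorem Connected.dist_map_le {W : Type*} {G : SimpleGraph W} (hT : T.Connected) (f : T →g G)
    (u w : V) : G.dist (f u) (f w) ≤ T.dist u w := by
  obtain ⟨p, hp⟩ := hT.exists_walk_length_eq_dist u w
  rw [← hp, ← Walk.length_map f p]
  exact dist_le _

end SimpleGraph

/-- If a group `H` acts on a tree `T` by graph automorphisms without inversions, and some
vertex has an orbit of finite diameter for the graph distance, then `H` fixes a vertex. -/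
theorem fixed_vertex_of_bounded_orbit_on_tree
    {V : Type*} (T : SimpleGraph V) (hT : T.IsTree)
    {H : Type*} [Group H] [MulAction H V]
    (hadj : ∀ (h : H) (v w : V), T.Adj v w → T.Adj (h • v) (h • w))
    (hnoinv : ∀ (h : H) (u w : V), T.Adj u w → ¬(h • u = w ∧ h • w = u))
    (v : V) (D : ℕ) (hD : ∀ h h' : H, T.dist (h • v) (h' • v) ≤ D) :
    ∃ w : V, ∀ h : H, h • w = w := by
  classical
  have hex : ∃ n, ∃ w, ∀ h : H, T.dist (h • v) w ≤ n :=
    ⟨D, v, fun h => by simpa using hD h 1⟩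
  obtain ⟨n, ⟨u, hu⟩, hmin⟩ : ∃ n, (∃ w, ∀ h : H, T.dist (h • v) w ≤ n) ∧
      ∀ k < n, ¬ ∃ w, ∀ h : H, T.dist (h • v) w ≤ k :=
    ⟨Nat.find hex, Nat.find_spec hex, fun _ => Nat.find_min hex⟩
  have hsmul (g : H) {w : V} (hw : ∀ h : H, T.dist (h • v) w ≤ n) (h : H) :
      T.dist (h • v) (g • w) ≤ n := by
    have := hT.connected.dist_map_le ⟨(g • ·), hadj g _ _⟩ ((g⁻¹ * h) • v) w
    simp only [RelHom.coeFn_mk, smul_smul, mul_inv_cancel_left] at this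
    exact this.trans (hw _)
  have hclose {a b : V} (ha : ∀ h : H, T.dist (h • v) a ≤ n)
      (hb : ∀ h : H, T.dist (h • v) b ≤ n) (hab : a ≠ b) : T.Adj a b := by
    by_contra hnadj
    obtain ⟨m, hm⟩ := hT.exists_forall_dist_lt_max
      (hT.connected.one_lt_dist_of_ne_of_not_adj hab hnadj)
    have hlt (h : H) : T.dist (h • v) m < n := (hm _).trans_le (max_le (ha h) (hb h))
    have := hlt 1
    exact hmin (n - 1) (by omega) ⟨m, fun h => by have := hlt h; omega⟩
  refine ⟨u, fun h => ?_⟩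
  by_contra hne
  have h₁ := hsmul h hu
  have hadj₁ : T.Adj u (h • u) := hclose hu h₁ (Ne.symm hne)
  have hne₂ : h • h • u ≠ u := fun h₂ => hnoinv h _ _ hadj₁ ⟨rfl, h₂⟩
  exact hT.not_adj_of_adj_of_adj hadj₁ (hadj h _ _ hadj₁)
    (hclose hu (hsmul h h₁) hne₂.symm)
end

section
/- Let K be an uncountable algebraically closed field of characteristic zero, and let V ⊆ Kⁿ be an irreducible Zariski-closed set. If (Z_i)_{i∈ℕ} is a countable family of Zariski-closed subsets of Kⁿ with V ⊆ ⋃_{i∈ℕ} Z_i, then V ⊆ Z_i for some i; in particular, an irreducible Zariski-closed subset of Kⁿ is not the union of countably many proper Zariski-closed subsets. -/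
/-- A Zariski-closed set `V` is irreducible if it is nonempty and is not the union of
two Zariski-closed proper subsets; equivalently, whenever `V` is covered by two
Zariski-closed sets it is contained in one of them. -/
def ZariskiIrreducible {K : Type*} [CommRing K] {n : ℕ} (V : Set (Fin n → K)) : Prop :=
  V.Nonempty ∧ ∀ Z₁ Z₂ : Set (Fin n → K), ZariskiClosed Z₁ → ZariskiClosed Z₂ →
    V ⊆ Z₁ ∪ Z₂ → V ⊆ Z₁ ∨ V ⊆ Z₂

/-- Over an uncountable field, a field extension of countable dimension is algebraic. -/
theorem algebra_isAlgebraic_of_rank_le_aleph0 {K L : Type*} [Field K] [Uncountable K] [Field L]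
    [Algebra K L] (h : Module.rank K L ≤ Cardinal.aleph0) : Algebra.IsAlgebraic K L := by
  by_contra hL
  obtain ⟨x, hx⟩ := (Algebra.transcendental_iff_not_isAlgebraic (R := K) (A := L)).2 hL
  have hle := hx.linearIndependent_sub_inv.cardinal_lift_le_rank
  have hK : Cardinal.mk K ≤ Cardinal.aleph0 :=
    Cardinal.lift_le_aleph0.1 (hle.trans (Cardinal.lift_le_aleph0.2 h))
  exact not_countable (α := K) (Cardinal.mk_le_aleph0_iff.1 hK)

/-- The weak Nullstellensatz in countably many variables over an uncountable algebraically
closed field. -/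
theorem exists_forall_eval_eq_zero_of_ne_top {K σ : Type*} [Field K] [IsAlgClosed K]
    [Uncountable K] [Countable σ] {I : Ideal (MvPolynomial σ K)} (hI : I ≠ ⊤) :
    ∃ x : σ → K, ∀ p ∈ I, MvPolynomial.eval x p = 0 := by
  obtain ⟨m, hm, hIm⟩ := Ideal.exists_le_maximal I hI
  let _ : Field (MvPolynomial σ K ⧸ m) := Ideal.Quotient.field m
  have hrank : Module.rank K (MvPolynomial σ K ⧸ m) ≤ Cardinal.aleph0 := by
    have hle := LinearMap.lift_rank_le_of_surjective (Ideal.Quotient.mkₐ K m).toLinearMap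
      (Ideal.Quotient.mkₐ_surjective K m)
    rw [MvPolynomial.rank_eq_lift] at hle
    exact Cardinal.lift_le_aleph0.1 (hle.trans (by simp))
  have := algebra_isAlgebraic_of_rank_le_aleph0 hrank
  let e : K ≃ₐ[K] (MvPolynomial σ K ⧸ m) := AlgEquiv.ofBijective (Algebra.ofId K _)
    IsAlgClosed.algebraMap_bijective_of_isIntegral
  let φ : MvPolynomial σ K →ₐ[K] K := e.symm.toAlgHom.comp (Ideal.Quotient.mkₐ K m)
  refine ⟨fun i => φ (MvPolynomial.X i), fun p hp => ?_⟩
  have hφ : MvPolynomial.aeval (fun i => φ (MvPolynomial.X i)) p = φ p :=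
    (DFunLike.congr_fun (MvPolynomial.aeval_unique φ) p).symm
  rw [← MvPolynomial.coe_aeval_eq_eval, RingHom.coe_coe, hφ]
  change e.symm (Ideal.Quotient.mk m p) = 0
  rw [Ideal.Quotient.eq_zero_iff_mem.2 (hIm hp), map_zero]

theorem zariskiClosed_setOf_eval_eq_zero {K : Type*} [CommRing K] {n : ℕ}
    (f : MvPolynomial (Fin n) K) : ZariskiClosed {x | MvPolynomial.eval x f = 0} :=
  ⟨{f}, by simp⟩

theorem ZariskiIrreducible.isPrime_vanishingIdeal {K : Type*} [Field K] {n : ℕ}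
    {V : Set (Fin n → K)} (hV : ZariskiIrreducible V) :
    (MvPolynomial.vanishingIdeal K V).IsPrime := by
  refine ⟨fun h => ?_, fun {f g} hfg => ?_⟩
  · obtain ⟨x, hx⟩ := hV.1
    have h1 : (1 : MvPolynomial (Fin n) K) ∈ MvPolynomial.vanishingIdeal K V := h ▸ trivial
    simpa using h1 x hx
  · have h := hV.2 _ _ (zariskiClosed_setOf_eval_eq_zero f) (zariskiClosed_setOf_eval_eq_zero g)
      fun x hx => by simpa using hfg x hx
    exact h

/-- Countably many polynomials, none of which vanishes identically on an irreducible
Zariski-closed set, have a common nonvanishing point on it. -/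
theorem ZariskiIrreducible.exists_mem_forall_eval_ne_zero {K ι : Type*} [Field K] [IsAlgClosed K]
    [Uncountable K] [Countable ι] {n : ℕ} {V : Set (Fin n → K)} (hVcl : ZariskiClosed V)
    (hV : ZariskiIrreducible V) (f : ι → MvPolynomial (Fin n) K)
    (hf : ∀ i, f i ∉ MvPolynomial.vanishingIdeal K V) :
    ∃ x ∈ V, ∀ i, MvPolynomial.eval x (f i) ≠ 0 := by
  have := hV.isPrime_vanishingIdeal
  let P := MvPolynomial.vanishingIdeal K V
  let F := FractionRing (MvPolynomial (Fin n) K ⧸ P)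
  let q : MvPolynomial (Fin n) K →ₐ[K] F :=
    (IsScalarTower.toAlgHom K (MvPolynomial (Fin n) K ⧸ P) F).comp (Ideal.Quotient.mkₐ K P)
  have hq (p : MvPolynomial (Fin n) K) : q p = 0 ↔ p ∈ P :=
    (FaithfulSMul.algebraMap_eq_zero_iff (MvPolynomial (Fin n) K ⧸ P) F).trans
      Ideal.Quotient.eq_zero_iff_mem
  let φ : MvPolynomial (Fin n ⊕ ι) K →ₐ[K] F :=
    MvPolynomial.aeval (Sum.elim (fun j => q (MvPolynomial.X j)) (fun i => (q (f i))⁻¹))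
  have hφ (p : MvPolynomial (Fin n) K) : φ (MvPolynomial.rename Sum.inl p) = q p := by
    rw [MvPolynomial.aeval_rename, Sum.elim_comp_inl]
    exact (DFunLike.congr_fun (MvPolynomial.aeval_unique q) p).symm
  obtain ⟨x, hx⟩ := exists_forall_eval_eq_zero_of_ne_top (RingHom.ker_ne_top φ)
  refine ⟨x ∘ Sum.inl, ?_, fun i hi => ?_⟩
  · obtain ⟨I, rfl⟩ := hVcl
    intro p hp
    rw [← MvPolynomial.eval_rename]
    exact hx _ ((hφ p).trans ((hq p).2 fun y hy => hy p hp))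
  · have h := hx (MvPolynomial.rename Sum.inl (f i) * MvPolynomial.X (Sum.inr i) - 1) (by
      rw [RingHom.mem_ker, map_sub, map_mul, hφ, map_one, MvPolynomial.aeval_X, Sum.elim_inr,
        mul_inv_cancel₀ (mt (hq _).1 (hf i)), sub_self])
    simp [MvPolynomial.eval_rename, hi] at h

/-- Over an uncountable algebraically closed field of characteristic zero, an irreducible
Zariski-closed set contained in a countable union of Zariski-closed sets is contained in
one of them; in particular, an irreducible Zariski-closed set is not the union of countably
many proper Zariski-closed subsets. -/
theorem irreducible_not_countable_union_of_closed
    {K : Type*} [Field K] [IsAlgClosed K] [CharZero K] [Uncountable K] {n : ℕ}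
    (V : Set (Fin n → K)) (hVcl : ZariskiClosed V) (hVirr : ZariskiIrreducible V) :
    (∀ Z : ℕ → Set (Fin n → K), (∀ i, ZariskiClosed (Z i)) →
        V ⊆ ⋃ i : ℕ, Z i → ∃ i : ℕ, V ⊆ Z i) ∧
    ¬ ∃ Z : ℕ → Set (Fin n → K),
        (∀ i, ZariskiClosed (Z i) ∧ Z i ⊆ V ∧ Z i ≠ V) ∧ V = ⋃ i : ℕ, Z i := by
  have key (Z : ℕ → Set (Fin n → K)) (hZ : ∀ i, ZariskiClosed (Z i)) (hcover : V ⊆ ⋃ i, Z i) :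
      ∃ i, V ⊆ Z i := by
    by_contra! hnot
    have hsep (i : ℕ) : ∃ p, p ∉ MvPolynomial.vanishingIdeal K V ∧
        ∀ x ∈ Z i, MvPolynomial.eval x p = 0 := by
      obtain ⟨I, hI⟩ := hZ i
      obtain ⟨x, hxV, hxZ⟩ := Set.not_subset.1 (hnot i)
      simp only [hI, Set.mem_ofPred_eq, not_forall] at hxZ ⊢
      obtain ⟨p, hp, hpx⟩ := hxZ
      exact ⟨p, fun h => hpx (h x hxV), fun y hy => hy p hp⟩
    choose f hfV hfZ using hsep
    obtain ⟨x, hxV, hx⟩ := hVirr.exists_mem_forall_eval_ne_zero hVcl f hfV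
    obtain ⟨i, hi⟩ := Set.mem_iUnion.1 (hcover hxV)
    exact hx i (hfZ i x hi)
  refine ⟨key, ?_⟩
  rintro ⟨Z, hZ, hVZ⟩
  obtain ⟨i, hi⟩ := key Z (fun i => (hZ i).1) hVZ.subset
  exact (hZ i).2.2 ((hZ i).2.1.antisymm hi)
end

section
/- Let K be an algebraically closed field of characteristic zero and n ∈ ℕ. If U is an open subscheme of affine n-space 𝔸ⁿ_K such that U is isomorphic to 𝔸ⁿ_K as a K-scheme, then U is all of 𝔸ⁿ_K, i.e., the open immersion U → 𝔸ⁿ_K is an isomorphism. -/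
open AlgebraicGeometry CategoryTheory

/-- Affine `n`-space over a field `K`, as the spectrum of `K[x_1,…,x_n]`. -/
noncomputable def AffineNSpace (K : Type*) [Field K] (n : ℕ) : Scheme :=
  Spec (CommRingCat.of (MvPolynomial (Fin n) K))

/-- The structure morphism of affine `n`-space over `K`. -/
noncomputable def AffineNSpace.structMap (K : Type*) [Field K] (n : ℕ) :
    AffineNSpace K n ⟶ Spec (CommRingCat.of K) :=
  Spec.map (CommRingCat.ofHom (algebraMap K (MvPolynomial (Fin n) K)))

/-- A flat homomorphism `f` from a unique factorization domain to a domain is bijective if every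
element of the target is a fraction of elements of the source and `f` creates no new units. -/
theorem RingHom.Flat.bijective_of_fractions {R S : Type*} [CommRing R] [IsDomain R]
    [UniqueFactorizationMonoid R] [CommRing S] [IsDomain S] {f : R →+* S} (hf : f.Flat)
    (hunits : ∀ q, IsUnit (f q) → ∃ u, IsUnit u ∧ f u = f q)
    (hfrac : ∀ s, ∃ a b, f b ≠ 0 ∧ f b * s = f a) :
    Function.Bijective f := by
  algebraize [f]
  refine ⟨FaithfulSMul.algebraMap_injective R S, fun s ↦ ?_⟩
  obtain ⟨a, b, hb, hab⟩ := hfrac s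
  have hb0 : b ≠ 0 := by rintro rfl; simp at hb
  obtain ⟨p, q, c, hpq, rfl, rfl⟩ := UniqueFactorizationMonoid.exists_reduced_factors' a b hb0
  simp only [map_mul, mul_assoc] at hab hb
  have hqp : f q * s = f p :=
    mul_left_cancel₀ (left_ne_zero_of_mul hb) hab
  have hrel : ∑ i, ![q, -p] i • ![s, 1] i = 0 := by
    simp [Algebra.smul_def, RingHom.algebraMap_toAlgebra, hqp]
  obtain ⟨k, r, y, hy, hr⟩ := Module.Flat.isTrivialRelation_of_sum_smul_eq_zero (R := R) (M := S) hrel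
  have hdvd : ∀ j, q ∣ r 1 j := fun j ↦ by
    refine hpq.symm.dvd_of_dvd_mul_left ⟨r 0 j, ?_⟩
    have := hr j
    simp only [Fin.sum_univ_two, Matrix.cons_val_zero, Matrix.cons_val_one] at this
    linear_combination -this
  have hunit : IsUnit (f q) := by
    refine isUnit_of_dvd_one ?_
    have h1 : (1 : S) = ∑ j, r 1 j • y j := by simpa using hy 1
    rw [h1]
    refine Finset.dvd_sum fun j _ ↦ ?_
    rw [Algebra.smul_def]
    exact (map_dvd _ (hdvd j)).mul_right _
  obtain ⟨_, ⟨u, rfl⟩, hu⟩ := hunits q hunit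
  refine ⟨↑u⁻¹ * p, ?_⟩
  rw [map_mul, ← hqp, ← hu, ← mul_assoc, ← map_mul, Units.inv_mul, map_one, one_mul]

/-- If `Spec S ⟶ Spec R` is an open immersion and `S` is a domain, every element of `S` is a
fraction of elements of `R`. -/
theorem AlgebraicGeometry.IsOpenImmersion.exists_mul_eq_of_specMap {R S : CommRingCat} [IsDomain S]
    (φ : R ⟶ S) [IsOpenImmersion (Spec.map φ)] (s : S) :
    ∃ a b : R, φ.hom b ≠ 0 ∧ φ.hom b * s = φ.hom a := by
  let p : PrimeSpectrum S := ⊥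
  have hbij : Function.Bijective
      (Localization.localRingHom (p.asIdeal.comap φ.hom) p.asIdeal φ.hom rfl) := by
    have h : IsIso ((Spec.map φ).stalkMap (show Spec S from p)) := inferInstance
    exact (ConcreteCategory.isIso_iff_bijective _).mp
      (((MorphismProperty.isomorphisms _).arrow_mk_iso_iff
        (Scheme.arrowStalkMapSpecIso φ p)).mp h)
  obtain ⟨x, hx⟩ := hbij.2 (algebraMap S (Localization.AtPrime p.asIdeal) s)
  obtain ⟨a, b, rfl⟩ := IsLocalization.exists_mk'_eq (p.asIdeal.comap φ.hom).primeCompl x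
  refine ⟨a, b, b.2, IsLocalization.injective (Localization.AtPrime p.asIdeal)
    p.asIdeal.primeCompl_le_nonZeroDivisors ?_⟩
  rw [Localization.localRingHom_mk'] at hx
  rw [map_mul, ← hx, mul_comm]
  exact IsLocalization.mk'_spec _ _ _

/-- An open immersion over `K` of affine space into itself is an isomorphism. -/
theorem AffineNSpace.isIso_of_isOpenImmersion {K : Type*} [Field K] {n : ℕ}
    (f : AffineNSpace K n ⟶ AffineNSpace K n) [IsOpenImmersion f]
    (hf : f ≫ structMap K n = structMap K n) : IsIso f := by
  obtain ⟨φ, rfl⟩ := Spec.map_surjective f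
  have hφ : ∀ c : K, φ.hom (MvPolynomial.C c) = MvPolynomial.C c := by
    have h := Spec.map_injective ((Spec.map_comp _ _).trans hf)
    exact fun c ↦ ConcreteCategory.congr_hom h c
  have : IsOpenImmersion (Spec.map φ) := ‹_›
  have hunit : ∀ q, IsUnit (φ.hom q) → ∃ c, IsUnit c ∧ φ.hom q = φ.hom (MvPolynomial.C c) :=
    fun q hq ↦ by simpa only [hφ] using MvPolynomial.isUnit_iff_eq_C_of_isReduced.mp hq
  have hbij : Function.Bijective φ.hom := by
    refine RingHom.Flat.bijective_of_fractions (Flat.SpecMap_iff.mp inferInstance) ?_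
      (IsOpenImmersion.exists_mul_eq_of_specMap φ)
    intro q hq
    obtain ⟨c, hc, h⟩ := hunit q hq
    exact ⟨_, hc.map MvPolynomial.C, h.symm⟩
  have : IsIso φ := (ConcreteCategory.isIso_iff_bijective φ).mpr hbij
  exact inferInstanceAs (IsIso (Spec.map φ))

/-- If an open subscheme `U` of affine `n`-space `𝔸ⁿ_K` over an algebraically closed field
of characteristic zero is isomorphic to `𝔸ⁿ_K` as a `K`-scheme, then `U` is all of `𝔸ⁿ_K`,
i.e. the open immersion `U → 𝔸ⁿ_K` is an isomorphism. -/
theorem open_subscheme_iso_affine_space_eq_top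
    {K : Type*} [Field K] [IsAlgClosed K] [CharZero K] (n : ℕ)
    (U : (AffineNSpace K n).Opens)
    (e : U.toScheme ≅ AffineNSpace K n)
    (he : e.hom ≫ AffineNSpace.structMap K n = U.ι ≫ AffineNSpace.structMap K n) :
    U = ⊤ ∧ IsIso U.ι := by
  have : IsIso (e.inv ≫ U.ι) := by
    refine AffineNSpace.isIso_of_isOpenImmersion _ ?_
    rw [Category.assoc, ← he, e.inv_hom_id_assoc]
  have hι : IsIso U.ι := IsIso.of_isIso_comp_left e.inv U.ι
  refine ⟨?_, hι⟩
  rw [← U.opensRange_ι]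
  exact Scheme.Hom.opensRange_of_isIso U.ι
end
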